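/- Let Ω ⊆ ℂ be a bounded domain such that the connected components of ∂Ω containing more than one point form a countable family {P_n} with Σ_n diam(P_n) < ∞. Let D be a circle domain whose boundary ∂D has σ-finite linear measure, and let φ : D → Ω be a conformal homeomorphism. Then φ admits a continuous extension φ̄ : closure(D) → closure(Ω) if and only if ∂Ω is a Peano compactum. -/

import Mathlib

open Set Metric Filter MeasureTheory Topology

noncomputable section

/-- A planar domain: a nonempty open connected subset of ℂ. -/
def IsPlanarDomain (D : Set ℂ) : Prop := D.Nonempty ∧ IsOpen D ∧ IsConnected D

/-- A Peano compactum: a compact subset of ℂ all of whose connected components are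
locally connected (as subspaces of ℂ) and such that for every `C > 0` only finitely
many components have diameter greater than `C`. -/
def IsPeanoCompactum (K : Set ℂ) : Prop :=
  IsCompact K ∧
  (∀ x ∈ K, LocallyConnectedSpace ↥(connectedComponentIn K x)) ∧
  ∀ C : ℝ, 0 < C →
    {Q : Set ℂ | (∃ x ∈ K, Q = connectedComponentIn K x) ∧ C < Metric.diam Q}.Finite

/-- A Jordan curve: a subset of ℂ homeomorphic to the unit circle. -/
def IsJordanCurve (J : Set ℂ) : Prop :=
  Nonempty (↥J ≃ₜ ↥(Metric.sphere (0:ℂ) 1))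

/-- A generalized Jordan domain: a bounded domain whose boundary is a Peano compactum,
each of whose boundary components is a single point or a Jordan curve. -/
def IsGeneralizedJordanDomain (D : Set ℂ) : Prop :=
  IsPlanarDomain D ∧ Bornology.IsBounded D ∧
  IsPeanoCompactum (frontier D) ∧
  ∀ x ∈ frontier D,
    connectedComponentIn (frontier D) x = {x} ∨
    IsJordanCurve (connectedComponentIn (frontier D) x)

/-- `φ` restricts to a homeomorphism of `D` onto `Ω`. -/
def IsHomeoOnto (φ : ℂ → ℂ) (D Ω : Set ℂ) : Prop :=
  ContinuousOn φ D ∧ Set.BijOn φ D Ω ∧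
  ∃ ψ : ℂ → ℂ, ContinuousOn ψ Ω ∧ Set.InvOn ψ φ D Ω

/-- `φ` is a conformal homeomorphism (holomorphic bijection) of `D` onto `Ω`. -/
def IsConformalHomeoOnto (φ : ℂ → ℂ) (D Ω : Set ℂ) : Prop :=
  DifferentiableOn ℂ φ D ∧ Set.BijOn φ D Ω

/-- `φb` is a continuous extension of `φ : D → Ω` to `closure D`, with values in `closure Ω`. -/
def ExtendsContinuously (φ φb : ℂ → ℂ) (D Ω : Set ℂ) : Prop :=
  ContinuousOn φb (closure D) ∧ Set.EqOn φb φ D ∧ Set.MapsTo φb (closure D) (closure Ω)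

/-- The oscDiam `σ_r(z₀) = diam φ(D ∩ C_r(z₀))`. -/
def oscDiam (φ : ℂ → ℂ) (D : Set ℂ) (z₀ : ℂ) (r : ℝ) : ℝ :=
  Metric.diam (φ '' (D ∩ Metric.sphere z₀ r))

/-- `liminf_{r→0⁺} σ_r(z₀) = 0`. -/
def OscLiminfZero (φ : ℂ → ℂ) (D : Set ℂ) (z₀ : ℂ) : Prop :=
  Filter.liminf (oscDiam φ D z₀) (nhdsWithin (0:ℝ) (Set.Ioi 0)) = 0

/-- A circle domain (normalized so that ∞ lies in a complementary disk): every bounded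
complementary component is a point or a closed round disk, and the unbounded
complementary component is the complement of an open round disk. -/
def IsCircleDomain (D : Set ℂ) : Prop :=
  IsPlanarDomain D ∧ Bornology.IsBounded D ∧
  ∀ x ∈ Dᶜ,
    (Bornology.IsBounded (connectedComponentIn Dᶜ x) →
      connectedComponentIn Dᶜ x = {x} ∨
      ∃ c : ℂ, ∃ rad : ℝ, 0 < rad ∧ connectedComponentIn Dᶜ x = Metric.closedBall c rad) ∧
    (¬ Bornology.IsBounded (connectedComponentIn Dᶜ x) →
      ∃ c : ℂ, ∃ rad : ℝ, 0 < rad ∧ connectedComponentIn Dᶜ x = (Metric.ball c rad)ᶜ)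

/-- A set has σ-finite linear (1-dimensional Hausdorff) measure. -/
def SigmaFiniteH1 (E : Set ℂ) : Prop :=
  ∃ f : ℕ → Set ℂ, (⋃ n, f n) = E ∧ ∀ n, μH[1] (f n) < ⊤

/-- The set of connected components of `K` containing more than one point. -/
def NondegComponents (K : Set ℂ) : Set (Set ℂ) :=
  {Q | (∃ x ∈ K, Q = connectedComponentIn K x) ∧ ∃ a ∈ Q, ∃ b ∈ Q, a ≠ b}

/-- The union of the singleton connected components of `K`. -/
def SingletonPart (K : Set ℂ) : Set ℂ :=
  {x | x ∈ K ∧ connectedComponentIn K x = {x}}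

/-- The cluster set `C(h, z₀) = ⋂_{r>0} closure h({z ∈ U : |z − z₀| < r})`. -/
def clusterSet (h : ℂ → ℂ) (U : Set ℂ) (z₀ : ℂ) : Set ℂ :=
  ⋂ r ∈ Set.Ioi (0:ℝ), closure (h '' (U ∩ Metric.ball z₀ r))

/-- The boundary component of `Ω` corresponding (under `φ : D → Ω`) to a boundary
component `Q` of `D`: `φ^B(Q) = ⋃_{z ∈ Q} C(φ, z)`. -/
def boundaryComp (φ : ℂ → ℂ) (D : Set ℂ) (Q : Set ℂ) : Set ℂ :=
  ⋃ z ∈ Q, clusterSet φ D z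

/-- An arc: the image of a continuous injective map from `[0,1]`. -/
def IsArc (A : Set ℂ) : Prop :=
  ∃ f : ℝ → ℂ, ContinuousOn f (Set.Icc 0 1) ∧ Set.InjOn f (Set.Icc 0 1) ∧
    f '' Set.Icc 0 1 = A

/-- An arc from `a` to `b`. -/
def IsArcFromTo (A : Set ℂ) (a b : ℂ) : Prop :=
  ∃ f : ℝ → ℂ, ContinuousOn f (Set.Icc 0 1) ∧ Set.InjOn f (Set.Icc 0 1) ∧
    f '' Set.Icc 0 1 = A ∧ f 0 = a ∧ f 1 = b

/-- Property S: for every `ε > 0`, `Ω` is a finite union of connected sets of diameter `< ε`. -/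
def PropertyS (Ω : Set ℂ) : Prop :=
  ∀ ε > (0:ℝ), ∃ (k : ℕ) (N : Fin k → Set ℂ),
    (∀ i, IsConnected (N i) ∧ Metric.diam (N i) < ε) ∧ (⋃ i, N i) = Ω

/-- `x ∈ ∂Ω` is locally accessible from `Ω`. -/
def LocallyAccessible (Ω : Set ℂ) (x : ℂ) : Prop :=
  ∀ ε > (0:ℝ), ∃ δ > (0:ℝ), ∀ z ∈ Ω, dist z x < δ →
    ∃ A : Set ℂ, IsArcFromTo A z x ∧ A ⊆ Ω ∪ {x} ∧ Metric.diam A < ε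

/-- `ξ ∈ ∂Ω` is locally sequentially accessible. -/
def LocallySeqAccessible (Ω : Set ℂ) (ξ : ℂ) : Prop :=
  ∀ r > (0:ℝ), ∀ ξn : ℕ → ℂ, (∀ n, ξn n ∈ Ω) → Filter.Tendsto ξn Filter.atTop (nhds ξ) →
    ∃ x ∈ Ω ∩ Metric.ball ξ r,
      {n : ℕ | ξn n ∈ connectedComponentIn (Ω ∩ Metric.ball ξ r) x}.Infinite

/-- `Ω` is finitely connected at the boundary point `x`. -/
def FinitelyConnectedAt (Ω : Set ℂ) (x : ℂ) : Prop :=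
  ∀ r > (0:ℝ), ∃ U : Set ℂ, IsOpen U ∧ x ∈ U ∧ U ⊆ Metric.ball x r ∧
    {Q : Set ℂ | ∃ y ∈ U ∩ Ω, Q = connectedComponentIn (U ∩ Ω) y}.Finite

/-- The diameter (Mazurkiewicz) distance on `Ω`. -/
def mazDist (Ω : Set ℂ) (x y : ℂ) : ℝ :=
  sInf (Metric.diam '' {E : Set ℂ | E ⊆ Ω ∧ IsConnected E ∧ x ∈ E ∧ y ∈ E})

/-- `Ω` is totally bounded for the Mazurkiewicz distance; for a metric space this is
equivalent to compactness of the metric completion of `(Ω, mazDist)`. -/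
def MazCompletionCompact (Ω : Set ℂ) : Prop :=
  ∀ ε > (0:ℝ), ∃ F : Finset ℂ, ↑F ⊆ Ω ∧ ∀ x ∈ Ω, ∃ y ∈ F, mazDist Ω x y < ε

/-- `f : A → B` is non-alternating: there are no `x, y ∈ B` and no separation of
`A \ f⁻¹({x})` into two disjoint nonempty relatively open sets `A₁, A₂` with
`y ∈ f(A₁) ∩ f(A₂)`. -/
def NonAlternatingOn (f : ℂ → ℂ) (A B : Set ℂ) : Prop :=
  ¬ ∃ x ∈ B, ∃ y ∈ B, ∃ A₁ A₂ : Set ℂ,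
      A₁.Nonempty ∧ A₂.Nonempty ∧ Disjoint A₁ A₂ ∧
      A₁ ∪ A₂ = {z | z ∈ A ∧ f z ≠ x} ∧
      (∃ U₁ : Set ℂ, IsOpen U₁ ∧ A₁ = U₁ ∩ {z | z ∈ A ∧ f z ≠ x}) ∧
      (∃ U₂ : Set ℂ, IsOpen U₂ ∧ A₂ = U₂ ∩ {z | z ∈ A ∧ f z ≠ x}) ∧
      y ∈ f '' A₁ ∧ y ∈ f '' A₂

/-- A continuous nowhere vanishing function on the plane has a continuous logarithm. -/
theorem exists_continuous_log {f : ℂ → ℂ} (hf : Continuous f) (h0 : ∀ z, f z ≠ 0) :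
    ∃ g : ℂ → ℂ, Continuous g ∧ ∀ z, Complex.exp (g z) = f z := by
  have hs : IsSimplyConnected (univ : Set ℂ) := by
    have : ContractibleSpace (univ : Set ℂ) := convex_univ.contractibleSpace univ_nonempty
    exact (inferInstance : SimplyConnectedSpace (univ : Set ℂ))
  obtain ⟨g, hg, hgf⟩ := Complex.exists_continuousOn_eqOn_exp_comp
    (X := ℂ) (U := univ) (g := f) hs isOpen_univ hf.continuousOn (by simpa using h0)
  exact ⟨g, continuousOn_univ.mp hg, fun z => hgf (mem_univ z)⟩

/-- Two continuous logarithms of the same function on a preconnected set differ by a constant. -/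
theorem sub_eq_sub_of_exp_eq {X : Type*} [TopologicalSpace X] {S : Set X}
    (hS : IsPreconnected S) {a b : X → ℂ} (ha : ContinuousOn a S) (hb : ContinuousOn b S)
    (hab : ∀ z ∈ S, Complex.exp (a z) = Complex.exp (b z)) {z w : X} (hz : z ∈ S) (hw : w ∈ S) :
    a z - b z = a w - b w := by
  have hn : ∀ z ∈ S, ∃ n : ℤ, a z - b z = n * (2 * Real.pi * Complex.I) := by
    intro z hz
    obtain ⟨n, hn⟩ := Complex.exp_eq_exp_iff_exists_int.mp (hab z hz)
    exact ⟨n, by rw [hn]; ring⟩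
  have hpi : (2 * Real.pi * Complex.I : ℂ) ≠ 0 := Complex.two_pi_I_ne_zero
  let h : X → ℝ := fun z => ((a z - b z) / (2 * Real.pi * Complex.I)).re
  have hh : ∀ z ∈ S, ∀ n : ℤ, a z - b z = n * (2 * Real.pi * Complex.I) → h z = n := by
    intro z _ n hzn
    simp only [h, hzn]
    rw [mul_div_assoc, div_self hpi]
    simp
  have hc : ContinuousOn h S :=
    Complex.continuous_re.comp_continuousOn ((ha.sub hb).div_const _)
  have ho : (h '' S).OrdConnected := (hS.image h hc).ordConnected
  have key : ∀ p ∈ S, ∀ q ∈ S, ¬ h p < h q := by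
    intro p hp q hq hlt
    obtain ⟨m, hm⟩ := hn p hp
    obtain ⟨n, hn'⟩ := hn q hq
    have e1 := hh p hp m hm
    have e2 := hh q hq n hn'
    rw [e1, e2] at hlt
    have hmn : m + 1 ≤ n := by exact_mod_cast hlt
    have hmn' : (m : ℝ) + 1 ≤ n := by exact_mod_cast hmn
    have hmem : (m : ℝ) + 1 / 2 ∈ h '' S :=
      ho.out (mem_image_of_mem h hp) (mem_image_of_mem h hq)
        ⟨by rw [e1]; linarith, by rw [e2]; linarith⟩
    obtain ⟨t, ht, hte⟩ := hmem
    obtain ⟨k, hk⟩ := hn t ht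
    rw [hh t ht k hk] at hte
    have : (2 * k : ℝ) = 2 * m + 1 := by linarith
    have : 2 * k = 2 * m + 1 := by exact_mod_cast this
    omega
  obtain ⟨m, hm⟩ := hn z hz
  obtain ⟨n, hn'⟩ := hn w hw
  have e := le_antisymm (not_lt.mp (key w hw z hz)) (not_lt.mp (key z hz w hw))
  rw [hh z hz m hm, hh w hw n hn'] at e
  rw [hm, hn']
  have : m = n := by exact_mod_cast e
  rw [this]

theorem continuousOn_ite_of_subset {O₁ O₂ G : Set ℂ} (h₁ : IsOpen O₁) (h₂ : IsOpen O₂)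
    (hd : Disjoint O₁ O₂) {t : ℂ → ℂ} (ht : Continuous t) {c : ℂ}
    (hG : ∀ z ∈ G, z ∈ O₁ ∨ z ∈ O₂ ∨ t z = c) [DecidablePred (· ∈ O₁)] :
    ContinuousOn (fun z => if z ∈ O₁ then t z else c) G := by
  intro p hp
  apply ContinuousAt.continuousWithinAt
  rcases hG p hp with h | h | h
  · refine ht.continuousAt.congr ?_
    filter_upwards [h₁.mem_nhds h] with z hz
    simp [hz]
  · refine (continuousAt_const (y := c)).congr ?_
    filter_upwards [h₂.mem_nhds h] with z hz
    simp [disjoint_right.mp hd hz]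
  · have hval : (if p ∈ O₁ then t p else c) = c := by split_ifs <;> simp [h]
    rw [ContinuousAt, hval, tendsto_iff_norm_sub_tendsto_zero]
    have h3 : Tendsto (fun z => ‖t z - c‖) (𝓝 p) (𝓝 0) := by
      have := tendsto_iff_norm_sub_tendsto_zero.mp (ht.tendsto p)
      rwa [h] at this
    refine squeeze_zero (fun _ => norm_nonneg _) (fun z => ?_) h3
    split_ifs <;> simp

/-- Unicoherence of the plane, for open sets. -/
theorem isPreconnected_inter_of_union_eq_univ {G H : Set ℂ} (hGo : IsOpen G) (hHo : IsOpen H)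
    (hG : IsPreconnected G) (hH : IsPreconnected H) (hu : G ∪ H = univ) :
    IsPreconnected (G ∩ H) := by
  classical
  intro U₁ U₂ hU₁ hU₂ hcov hne₁ hne₂
  by_contra hcon
  obtain ⟨O₁, hO₁⟩ : ∃ O, O = G ∩ H ∩ U₁ := ⟨_, rfl⟩
  obtain ⟨O₂, hO₂⟩ : ∃ O, O = G ∩ H ∩ U₂ := ⟨_, rfl⟩
  have ho₁ : IsOpen O₁ := hO₁ ▸ (hGo.inter hHo).inter hU₁
  have ho₂ : IsOpen O₂ := hO₂ ▸ (hGo.inter hHo).inter hU₂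
  have hd : Disjoint O₁ O₂ := by
    rw [disjoint_left]
    rintro z h1 h2
    rw [hO₁] at h1
    rw [hO₂] at h2
    exact hcon ⟨z, h1.1, h1.2, h2.2⟩
  obtain ⟨t, ht0, ht1, -⟩ := exists_continuous_zero_one_of_isClosed hGo.isClosed_compl
    hHo.isClosed_compl (by
      rw [disjoint_left]
      intro z h1 h2
      exact (hu ▸ mem_univ z : z ∈ G ∪ H).elim h1 h2)
  let c : ℂ := 2 * Real.pi * Complex.I
  let T : ℂ → ℂ := fun z => c * (t z : ℂ)
  have hT : Continuous T := by fun_prop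
  have hcase : ∀ z, z ∈ G → z ∈ H → z ∈ O₁ ∨ z ∈ O₂ := by
    intro z h1 h2
    rw [hO₁, hO₂]
    exact (hcov ⟨h1, h2⟩).imp (fun h => ⟨⟨h1, h2⟩, h⟩) (fun h => ⟨⟨h1, h2⟩, h⟩)
  let a : ℂ → ℂ := fun z => if z ∈ O₁ then T z else c
  let b : ℂ → ℂ := fun z => if z ∈ O₁ then T z else 0
  have ha : ContinuousOn a G := continuousOn_ite_of_subset ho₁ ho₂ hd hT fun z hz => by
    by_cases hzH : z ∈ H
    · exact (hcase z hz hzH).imp id Or.inl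
    · right; right
      simp [T, ht1 (show z ∈ Hᶜ from hzH)]
  have hb : ContinuousOn b H := continuousOn_ite_of_subset ho₁ ho₂ hd hT fun z hz => by
    by_cases hzG : z ∈ G
    · exact (hcase z hzG hz).imp id Or.inl
    · right; right
      simp [T, ht0 (show z ∈ Gᶜ from hzG)]
  have hab : ∀ z, Complex.exp (a z) = Complex.exp (b z) := by
    intro z
    by_cases hz : z ∈ O₁
    · simp [a, b, hz]
    · simp [a, b, hz, c, Complex.exp_two_pi_mul_I]
  have hf : Continuous fun z => Complex.exp (b z) := by
    rw [continuous_iff_continuousAt]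
    intro z
    rcases (hu ▸ mem_univ z : z ∈ G ∪ H) with hz | hz
    · have := (ha.continuousAt (hGo.mem_nhds hz)).cexp
      simpa only [hab] using this
    · exact (hb.continuousAt (hHo.mem_nhds hz)).cexp
  obtain ⟨g, hg, hgf⟩ := exists_continuous_log hf fun z => Complex.exp_ne_zero _
  obtain ⟨p, hp, hp1⟩ := hne₁
  obtain ⟨q, hq, hq1⟩ := hne₂
  have hpO : p ∈ O₁ := hO₁ ▸ ⟨hp, hp1⟩
  have hqO : q ∉ O₁ := disjoint_right.mp hd (hO₂ ▸ ⟨hq, hq1⟩)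
  have e1 := sub_eq_sub_of_exp_eq hG hg.continuousOn ha (fun z _ => (hgf z).trans (hab z).symm)
    hp.1 hq.1
  have e2 := sub_eq_sub_of_exp_eq hH hg.continuousOn hb (fun z _ => hgf z) hp.2 hq.2
  have : c = 0 := by
    simp only [a, b, hpO, hqO, if_true, if_false] at e1 e2
    rw [e1] at e2
    simpa using e2
  exact Complex.two_pi_I_ne_zero this

theorem exists_log_div_of_preconnected {K Y : Set ℂ} (hK : IsClosed K) (hY : IsPreconnected Y)
    (hd : Disjoint Y K) {x y : ℂ} (hx : x ∈ Y) (hy : y ∈ Y) :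
    ∃ g : ℂ → ℂ, ContinuousOn g K ∧ ∀ z ∈ K, Complex.exp (g z) = (z - x) / (z - y) := by
  have hne : ∀ {z w}, z ∈ K → w ∈ Y → z - w ≠ 0 := fun {z w} hz hw h =>
    disjoint_left.mp hd hw (sub_eq_zero.mp h ▸ hz)
  refine hY.induction₂ (fun x y => ∃ g : ℂ → ℂ, ContinuousOn g K ∧
    ∀ z ∈ K, Complex.exp (g z) = (z - x) / (z - y)) ?_ ?_ ?_ hx hy
  · intro x hx
    obtain ⟨d, hd0, hdK⟩ := Metric.isOpen_iff.mp hK.isOpen_compl x (disjoint_left.mp hd hx)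
    filter_upwards [self_mem_nhdsWithin,
      mem_nhdsWithin_of_mem_nhds (ball_mem_nhds x (half_pos hd0))] with y hyY hyd
    have hsl : ∀ z ∈ K, (z - x) / (z - y) ∈ Complex.slitPlane := by
      intro z hz
      have hzd : d ≤ dist z x := by
        by_contra h
        exact hdK (not_le.mp h) hz
      have h1 : dist z x ≤ dist z y + dist y x := dist_triangle _ _ _
      have h2 : dist y x < d / 2 := hyd
      have h3 : dist y x < dist z y := by linarith
      have : (z - x) / (z - y) = 1 + (y - x) / (z - y) := by
        field_simp [hne hz hyY]
        ring
      rw [this]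
      apply Complex.mem_slitPlane_of_norm_lt_one
      rw [norm_div, ← dist_eq_norm, ← dist_eq_norm]
      exact (div_lt_one (dist_nonneg.trans_lt h3)).mpr h3
    refine ⟨fun z => Complex.log ((z - x) / (z - y)), ?_, ?_⟩
    · refine ContinuousOn.clog ?_ hsl
      exact ContinuousOn.div (by fun_prop) (by fun_prop) fun z hz => hne hz hyY
    · intro z hz
      exact Complex.exp_log (Complex.slitPlane_ne_zero (hsl z hz))
  · rintro x y w hx hy hw ⟨g, hg, hg'⟩ ⟨k, hk, hk'⟩
    refine ⟨fun z => g z + k z, hg.add hk, fun z hz => ?_⟩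
    rw [Complex.exp_add, hg' z hz, hk' z hz]
    have := hne hz hy
    have := hne hz hw
    field_simp
  · rintro x y hx hy ⟨g, hg, hg'⟩
    refine ⟨fun z => -g z, hg.neg, fun z hz => ?_⟩
    rw [Complex.exp_neg, hg' z hz, inv_div]

/-- Easy half of Borsuk's criterion: points in different pieces of the complement of `K` rule out a
continuous logarithm of `(z - x) / (z - y)` on `K`. -/
theorem false_of_log_div_of_separated {K U V : Set ℂ} (hK : IsClosed K) (hU : IsOpen U)
    (hV : IsOpen V) (hd : Disjoint U V) (hUV : U ∪ V = Kᶜ) {x y : ℂ} (hx : x ∈ U) (hy : y ∈ V)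
    (hb : Bornology.IsBounded U) {g : ℂ → ℂ} (hg : ContinuousOn g K)
    (hgK : ∀ z ∈ K, Complex.exp (g z) = (z - x) / (z - y)) : False := by
  classical
  obtain ⟨G, hG⟩ := ContinuousMap.exists_restrict_eq hK ⟨_, hg.domRestrict⟩
  have hGg : ∀ z ∈ K, G z = g z := fun z hz => congrArg (fun f => f ⟨z, hz⟩) hG
  have hxK : x ∉ K := fun h => (hUV ▸ Or.inl hx : x ∈ Kᶜ) h
  have hyK : y ∉ K := fun h => (hUV ▸ Or.inr hy : y ∈ Kᶜ) h
  let h : ℂ → ℂ := U.piecewise (fun z => (z - y) * Complex.exp (G z)) (fun z => z - x)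
  have hfr : ∀ z ∈ frontier U, z ∈ K := by
    intro z hz
    by_contra hzK
    rcases (hUV ▸ hzK : z ∈ U ∪ V) with h1 | h1
    · rw [hU.frontier_eq] at hz
      exact hz.2 h1
    · exact disjoint_left.mp (hd.closure_left hV) hz.1 h1
  have hc : Continuous h := by
    refine Continuous.piecewise (fun z hz => ?_) (by fun_prop) (by fun_prop)
    have hzK := hfr z hz
    rw [hGg z hzK, hgK z hzK]
    have : z - y ≠ 0 := fun e => hyK (sub_eq_zero.mp e ▸ hzK)
    field_simp
  have h0 : ∀ z, h z ≠ 0 := by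
    intro z
    by_cases hz : z ∈ U
    · simp only [h, piecewise_eq_of_mem _ _ _ hz]
      refine mul_ne_zero (fun e => ?_) (Complex.exp_ne_zero _)
      exact disjoint_left.mp hd hz (sub_eq_zero.mp e ▸ hy)
    · simp only [h, piecewise_eq_of_notMem _ _ _ hz]
      exact fun e => hz (sub_eq_zero.mp e ▸ hx)
  obtain ⟨L, hL, hLh⟩ := exists_continuous_log hc h0
  obtain ⟨R, hR0, hR⟩ := hb.subset_ball_lt 0 x
  have e := sub_eq_sub_of_exp_eq (X := ℝ) (S := univ) isPreconnected_univ
    (a := fun θ => L (circleMap x R θ)) (b := fun θ => (Real.log R : ℂ) + θ * Complex.I)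
    (hL.comp (continuous_circleMap x R)).continuousOn (by fun_prop) (fun θ _ => by
      rw [hLh]
      have : circleMap x R θ ∉ U := fun hm => by
        have := hR hm
        rw [mem_ball, dist_eq_norm, circleMap_sub_center] at this
        simp [abs_of_pos hR0] at this
      have hv : h (circleMap x R θ) = R * Complex.exp (θ * Complex.I) := by
        simp only [h, piecewise_eq_of_notMem _ _ _ this]
        simp [circleMap]
      rw [hv, Complex.exp_add, ← Complex.ofReal_exp, Real.exp_log hR0]) (mem_univ 0) (mem_univ (2 * Real.pi))
  have hper : circleMap x R (2 * Real.pi) = circleMap x R 0 := by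
    simpa using periodic_circleMap x R 0
  simp only [hper] at e
  have : (2 * Real.pi * Complex.I : ℂ) = 0 := by
    push_cast at e
    linear_combination e
  exact Complex.two_pi_I_ne_zero this

/-- Janiszewski's theorem: two closed sets with preconnected intersection, neither of which
separates `x` from `y`, have a union which does not separate `x` from `y`. -/
theorem janiszewski {A E Y Z U V : Set ℂ} (hA : IsClosed A) (hE : IsClosed E)
    (hAE : IsPreconnected (A ∩ E)) {x y : ℂ}
    (hY : IsPreconnected Y) (hYA : Disjoint Y A) (hxY : x ∈ Y) (hyY : y ∈ Y)
    (hZ : IsPreconnected Z) (hZE : Disjoint Z E) (hxZ : x ∈ Z) (hyZ : y ∈ Z)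
    (hU : IsOpen U) (hV : IsOpen V) (hd : Disjoint U V) (hUV : U ∪ V = (A ∪ E)ᶜ)
    (hx : x ∈ U) (hy : y ∈ V) (hb : Bornology.IsBounded U ∨ Bornology.IsBounded V) : False := by
  classical
  wlog hbU : Bornology.IsBounded U generalizing U V x y
  · exact this hyY hxY hyZ hxZ hV hU hd.symm (by rw [union_comm, hUV]) hy hx hb.symm
      (hb.resolve_left hbU)
  obtain ⟨g, hg, hg'⟩ := exists_log_div_of_preconnected hA hY hYA hxY hyY
  obtain ⟨k, hk, hk'⟩ := exists_log_div_of_preconnected hE hZ hZE hxZ hyZ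
  obtain ⟨c, hc, hc1⟩ : ∃ c : ℂ, (∀ z ∈ A ∩ E, g z = k z + c) ∧ Complex.exp c = 1 := by
    rcases (A ∩ E).eq_empty_or_nonempty with h | ⟨p, hp⟩
    · exact ⟨0, by simp [h], by simp⟩
    · refine ⟨g p - k p, fun z hz => ?_, ?_⟩
      · rw [← sub_eq_sub_of_exp_eq hAE (hg.mono inter_subset_left) (hk.mono inter_subset_right)
          (fun z hz => (hg' z hz.1).trans (hk' z hz.2).symm) hz hp]
        ring
      · rw [Complex.exp_sub, hg' p hp.1, hk' p hp.2, div_self]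
        rw [← hk' p hp.2]
        exact Complex.exp_ne_zero _
  have hcont : ContinuousOn (A.piecewise g fun z => k z + c) (A ∪ E) := by
    have h1 : ContinuousOn (A.piecewise g fun z => k z + c) A :=
      hg.congr fun z hz => piecewise_eq_of_mem _ _ _ hz
    have h2 : ContinuousOn (A.piecewise g fun z => k z + c) E := by
      refine ContinuousOn.congr (f := fun z => k z + c) (hk.add continuousOn_const) fun z hz => ?_
      by_cases hzA : z ∈ A
      · rw [piecewise_eq_of_mem _ _ _ hzA, hc z ⟨hzA, hz⟩]
      · rw [piecewise_eq_of_notMem _ _ _ hzA]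
    exact h1.union_of_isClosed h2 hA hE
  refine false_of_log_div_of_separated (hA.union hE) hU hV hd hUV hx hy hbU hcont ?_
  intro z hz
  by_cases hzA : z ∈ A
  · rw [piecewise_eq_of_mem _ _ _ hzA, hg' z hzA]
  · rw [piecewise_eq_of_notMem _ _ _ hzA, Complex.exp_add, hc1, mul_one,
      hk' z (hz.resolve_left hzA)]

theorem isClosed_connectedComponentIn {X : Type*} [TopologicalSpace X] {K : Set X}
    (hK : IsClosed K) (x : X) : IsClosed (connectedComponentIn K x) := by
  by_cases hx : x ∈ K
  · rw [connectedComponentIn_eq_image hx]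
    exact hK.isClosedEmbedding_subtypeVal.isClosedMap _ isClosed_connectedComponent
  · rw [connectedComponentIn_eq_empty hx]
    exact isClosed_empty

theorem connectedComponentIn_eq_of_mem_of_mem {X : Type*} [TopologicalSpace X] {K : Set X}
    {x y p : X} (hx : p ∈ connectedComponentIn K x) (hy : p ∈ connectedComponentIn K y) :
    connectedComponentIn K x = connectedComponentIn K y :=
  (connectedComponentIn_eq hx).trans (connectedComponentIn_eq hy).symm

/-- In a compact set, a component has arbitrarily small relatively clopen neighbourhoods. -/
theorem IsCompact.exists_clopen_between {M : Set ℂ} (hM : IsCompact M) {x : ℂ} (hx : x ∈ M)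
    {N : Set ℂ} (hN : IsOpen N) (hxN : connectedComponentIn M x ⊆ N) :
    ∃ F, IsClosed F ∧ IsClosed (M \ F) ∧ connectedComponentIn M x ⊆ F ∧ F ⊆ N ∧ F ⊆ M := by
  have : CompactSpace M := isCompact_iff_compactSpace.mp hM
  rw [connectedComponentIn_eq_image hx] at hxN ⊢
  have hemb := hM.isClosed.isClosedEmbedding_subtypeVal
  have key : ∃ i : { s : Set M // IsClopen s ∧ (⟨x, hx⟩ : M) ∈ s },
      (i : Set M) ⊆ Subtype.val ⁻¹' N := by
    have : Nonempty { s : Set M // IsClopen s ∧ (⟨x, hx⟩ : M) ∈ s } :=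
      ⟨⟨univ, isClopen_univ, mem_univ _⟩⟩
    refine exists_subset_nhds_of_compactSpace ?_ (fun i => i.2.1.isClosed) ?_
    · intro s t
      exact ⟨⟨s.1 ∩ t.1, s.2.1.inter t.2.1, s.2.2, t.2.2⟩, inter_subset_left, inter_subset_right⟩
    · intro y hy
      rw [← connectedComponent_eq_iInter_isClopen] at hy
      exact (hN.preimage continuous_subtype_val).mem_nhds (hxN (mem_image_of_mem _ hy))
  obtain ⟨⟨s, hs, hxs⟩, hsN⟩ := key
  refine ⟨Subtype.val '' s, hemb.isClosedMap _ hs.isClosed, ?_,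
    image_mono (hs.connectedComponent_subset hxs), image_subset_iff.mpr hsN, by simp⟩
  have : M \ Subtype.val '' s = Subtype.val '' sᶜ := by
    ext z
    constructor
    · rintro ⟨hz, hzs⟩
      exact ⟨⟨z, hz⟩, fun h => hzs ⟨_, h, rfl⟩, rfl⟩
    · rintro ⟨w, hw, rfl⟩
      refine ⟨w.2, ?_⟩
      rintro ⟨v, hv, hvw⟩
      exact hw (Subtype.ext hvw ▸ hv)
  rw [this]
  exact hemb.isClosedMap _ hs.compl.isClosed

/-- The radial retraction of the plane onto the closed disk of radius `R`. -/
def radialRetract (R : ℝ) (z : ℂ) : ℂ := ((R / max R ‖z‖ : ℝ) : ℂ) * z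

theorem continuous_radialRetract {R : ℝ} (hR : 0 < R) : Continuous (radialRetract R) := by
  have : Continuous fun z : ℂ => R / max R ‖z‖ :=
    continuous_const.div (by fun_prop) fun z => (lt_max_of_lt_left hR).ne'
  exact (Complex.continuous_ofReal.comp this).mul continuous_id

theorem radialRetract_of_le {R : ℝ} (hR : 0 < R) {z : ℂ} (hz : ‖z‖ ≤ R) :
    radialRetract R z = z := by
  simp [radialRetract, max_eq_left hz, hR.ne']

theorem norm_radialRetract_of_ge {R : ℝ} (hR : 0 < R) {z : ℂ} (hz : R ≤ ‖z‖) :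
    ‖radialRetract R z‖ = R := by
  have : 0 < ‖z‖ := hR.trans_le hz
  simp [radialRetract, max_eq_right hz, abs_of_pos hR, this.ne']

theorem norm_radialRetract_le {R : ℝ} (hR : 0 < R) (z : ℂ) : ‖radialRetract R z‖ ≤ R := by
  rcases le_total ‖z‖ R with h | h
  · rwa [radialRetract_of_le hR h]
  · exact (norm_radialRetract_of_ge hR h).le

theorem isPreconnected_compl_ball (c : ℂ) (r : ℝ) : IsPreconnected (ball c r)ᶜ := by
  rcases lt_or_ge 0 r with hr | hr
  · have h1 : (ball c r)ᶜ = (fun p : ℝ × ℝ => circleMap c p.1 p.2) '' (Ici r ×ˢ univ) := by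
      ext z
      constructor
      · intro hz
        have hz' : r ≤ ‖z - c‖ := by simpa [dist_eq_norm] using hz
        refine ⟨(‖z - c‖, Complex.arg (z - c)), ⟨hz', mem_univ _⟩, ?_⟩
        simp [circleMap, Complex.norm_mul_exp_arg_mul_I]
      · rintro ⟨⟨ρ, θ⟩, ⟨hρ, -⟩, rfl⟩
        have : r ≤ |ρ| := le_trans hρ (le_abs_self ρ)
        simpa [dist_eq_norm] using this
    rw [h1]
    refine IsPreconnected.image (isPreconnected_Ici.prod isPreconnected_univ) _ ?_
    unfold circleMap
    fun_prop
  · rw [ball_eq_empty.mpr hr, compl_empty]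
    exact isPreconnected_univ

section Domain

variable {D : Set ℂ}

/-- A component of the complement of a bounded open set has arbitrarily small relatively clopen
neighbourhoods. -/
theorem exists_clopen_between (hDo : IsOpen D) (hDb : Bornology.IsBounded D) {x : ℂ}
    (hx : x ∈ Dᶜ) {N : Set ℂ} (hN : IsOpen N) (hxN : connectedComponentIn Dᶜ x ⊆ N) :
    ∃ F, IsClosed F ∧ IsClosed (Dᶜ \ F) ∧ connectedComponentIn Dᶜ x ⊆ F ∧ F ⊆ N ∧ F ⊆ Dᶜ := by
  obtain ⟨R, hR, hDR⟩ := hDb.subset_ball_lt 0 0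
  have hout : (ball (0 : ℂ) R)ᶜ ⊆ Dᶜ := compl_subset_compl.mpr hDR
  have hcon := isPreconnected_compl_ball 0 R
  set E := connectedComponentIn Dᶜ x with hE
  have hED : E ⊆ Dᶜ := connectedComponentIn_subset _ _
  have hoE : ∀ p ∈ E, p ∈ (ball (0 : ℂ) R)ᶜ → (ball (0 : ℂ) R)ᶜ ⊆ E := by
    intro p hp hpo
    rw [hE, connectedComponentIn_eq hp]
    exact hcon.subset_connectedComponentIn hpo hout
  set M := Dᶜ ∩ closedBall (0 : ℂ) R with hMdef
  have hM : IsCompact M := (isCompact_closedBall _ _).inter_left hDo.isClosed_compl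
  have hρ := continuous_radialRetract hR
  have hρo : ∀ z, z ∉ ball (0 : ℂ) R → radialRetract R z ∈ (ball (0 : ℂ) R)ᶜ := by
    intro z hz
    have : R ≤ ‖z‖ := by simpa using hz
    simp [norm_radialRetract_of_ge hR this]
  have hρi : ∀ z, z ∈ ball (0 : ℂ) R → radialRetract R z = z := by
    intro z hz
    exact radialRetract_of_le hR (by simpa using (mem_ball.mp hz).le)
  have hρE : ∀ z ∈ E, radialRetract R z ∈ E := by
    intro z hz
    by_cases hzb : z ∈ ball (0 : ℂ) R
    · rwa [hρi z hzb]
    · exact hoE z hz hzb (hρo z hzb)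
  have hρD : ∀ z ∈ Dᶜ, radialRetract R z ∈ M := by
    intro z hz
    refine ⟨?_, by simpa using norm_radialRetract_le hR z⟩
    by_cases hzb : z ∈ ball (0 : ℂ) R
    · rwa [hρi z hzb]
    · exact hout (hρo z hzb)
  have hxE : x ∈ E := mem_connectedComponentIn hx
  have hcomp : connectedComponentIn M (radialRetract R x) ⊆ E := by
    rw [hE, connectedComponentIn_eq (hρE x hxE)]
    exact connectedComponentIn_mono _ inter_subset_left
  have hρsub : radialRetract R '' E ⊆ connectedComponentIn M (radialRetract R x) :=
    (isPreconnected_connectedComponentIn.image _ hρ.continuousOn).subset_connectedComponentIn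
      (mem_image_of_mem _ hxE) (by
        rintro _ ⟨z, hz, rfl⟩
        exact hρD z (hED hz))
  obtain ⟨N', hN', hEN', hN'N, hN'o⟩ : ∃ N', IsOpen N' ∧ E ⊆ N' ∧ N' ⊆ N ∧
      ∀ z ∈ N', z ∉ ball (0 : ℂ) R → (ball (0 : ℂ) R)ᶜ ⊆ N := by
    by_cases h : ∃ p ∈ E, p ∈ (ball (0 : ℂ) R)ᶜ
    · obtain ⟨p, hp, hpo⟩ := h
      exact ⟨N, hN, hxN, subset_rfl, fun _ _ _ => (hoE p hp hpo).trans hxN⟩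
    · push Not at h
      refine ⟨N ∩ ball 0 R, hN.inter isOpen_ball, subset_inter hxN fun z hz => ?_,
        inter_subset_left, fun z hz hz' => absurd hz.2 hz'⟩
      by_contra hzb
      exact h z hz hzb
  obtain ⟨F, hF, hMF, hxF, hFN, hFM⟩ :=
    hM.exists_clopen_between (hρD x hx) hN' (hcomp.trans hEN')
  refine ⟨Dᶜ ∩ radialRetract R ⁻¹' F, hDo.isClosed_compl.inter (hF.preimage hρ), ?_,
    fun z hz => ⟨hED hz, hxF (hρsub (mem_image_of_mem _ hz))⟩, ?_, inter_subset_left⟩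
  · have : Dᶜ \ (Dᶜ ∩ radialRetract R ⁻¹' F) = Dᶜ ∩ radialRetract R ⁻¹' (M \ F) := by
      ext z
      constructor
      · rintro ⟨hz, hz'⟩
        exact ⟨hz, hρD z hz, fun h => hz' ⟨hz, h⟩⟩
      · rintro ⟨hz, -, hz'⟩
        exact ⟨hz, fun h => hz' h.2⟩
    rw [this]
    exact hDo.isClosed_compl.inter (hMF.preimage hρ)
  · rintro z ⟨hz, hzF⟩
    have hzF : radialRetract R z ∈ F := hzF
    by_cases hzb : z ∈ ball (0 : ℂ) R
    · rw [hρi z hzb] at hzF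
      exact hN'N (hFN hzF)
    · exact hN'o _ (hFN hzF) (hρo z hzb) hzb

/-- Every component of the complement of a nonempty open set touches the set. -/
theorem exists_mem_connectedComponentIn_closure (hDo : IsOpen D) (hDne : D.Nonempty) {x : ℂ}
    (hx : x ∈ Dᶜ) : ∃ y ∈ connectedComponentIn Dᶜ x, y ∈ closure D := by
  by_contra! hcon
  have hcl : IsClosed (connectedComponentIn Dᶜ x) :=
    isClosed_connectedComponentIn hDo.isClosed_compl x
  have hop : IsOpen (connectedComponentIn Dᶜ x) := by
    rw [Metric.isOpen_iff]
    intro y hy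
    obtain ⟨ε, hε, hb⟩ := Metric.isOpen_iff.mp isClosed_closure.isOpen_compl y (hcon y hy)
    refine ⟨ε, hε, ?_⟩
    rw [connectedComponentIn_eq hy]
    exact (convex_ball y ε).isPreconnected.subset_connectedComponentIn (mem_ball_self hε)
      (hb.trans (compl_subset_compl.mpr subset_closure))
  have := IsClopen.eq_univ ⟨hcl, hop⟩ ⟨x, mem_connectedComponentIn hx⟩
  obtain ⟨d, hd⟩ := hDne
  exact connectedComponentIn_subset Dᶜ x (this ▸ mem_univ d) hd

/-- The union of a domain with a family of components of its complement is connected. -/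
theorem isPreconnected_union_components (hDo : IsOpen D) (hD : IsConnected D) {S : Set ℂ}
    (hDS : D ⊆ S) (hS : ∀ y ∈ S, y ∉ D → connectedComponentIn Dᶜ y ⊆ S) : IsPreconnected S := by
  obtain ⟨d, hd⟩ := hD.nonempty
  refine isPreconnected_of_forall d fun y hy => ?_
  by_cases hyD : y ∈ D
  · exact ⟨D, hDS, hd, hyD, hD.isPreconnected⟩
  · obtain ⟨p, hp, hpD⟩ := exists_mem_connectedComponentIn_closure hDo hD.nonempty hyD
    refine ⟨insert p D ∪ connectedComponentIn Dᶜ y, ?_, Or.inl (Or.inr hd),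
      Or.inr (mem_connectedComponentIn hyD), ?_⟩
    · exact union_subset (insert_subset (hS y hy hyD hp) hDS) (hS y hy hyD)
    · refine IsPreconnected.union p (mem_insert _ _) hp ?_ isPreconnected_connectedComponentIn
      exact hD.isPreconnected.subset_closure (subset_insert _ _)
        (insert_subset hpD subset_closure)

theorem exists_connected_nhd (hDo : IsOpen D) (hD : IsConnected D)
    (hDb : Bornology.IsBounded D) {x : ℂ} (hx : x ∈ Dᶜ) {N : Set ℂ} (hN : IsOpen N)
    (hxN : connectedComponentIn Dᶜ x ⊆ N) :
    ∃ G, IsOpen G ∧ connectedComponentIn Dᶜ x ⊆ G ∧ G ⊆ N ∧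
      (∀ y ∈ G, y ∉ D → connectedComponentIn Dᶜ y ⊆ G) ∧ IsPreconnected (G ∩ D) := by
  obtain ⟨F, hF, hDF, hxF, hFN, hFD⟩ := exists_clopen_between hDo hDb hx hN hxN
  set N' := N \ (Dᶜ \ F) with hN'
  have hN'o : IsOpen N' := hN.sdiff hDF
  have hFN' : F ⊆ N' := fun z hz => ⟨hFN hz, fun h => h.2 hz⟩
  have hFcomp : ∀ y ∈ F, connectedComponentIn Dᶜ y ⊆ F := by
    intro y hy z hz
    by_contra hzF
    have hpre : IsPreconnected (connectedComponentIn Dᶜ y) := isPreconnected_connectedComponentIn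
    have hsub := connectedComponentIn_subset Dᶜ y
    obtain ⟨w, -, hw1, hw2⟩ := (isPreconnected_closed_iff.mp hpre) F (Dᶜ \ F) hF hDF
      (fun w hw => (em (w ∈ F)).imp id fun h => ⟨hsub hw, h⟩)
      ⟨y, mem_connectedComponentIn (hFD hy), hy⟩ ⟨z, hz, hsub hz, hzF⟩
    exact hw2.2 hw1
  set G := connectedComponentIn N' x with hG
  have hxx : x ∈ N' := hFN' (hxF (mem_connectedComponentIn hx))
  have hGo : IsOpen G := hN'o.connectedComponentIn
  have hGN' : G ⊆ N' := connectedComponentIn_subset _ _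
  have hGsat : ∀ y ∈ G, y ∉ D → connectedComponentIn Dᶜ y ⊆ G := by
    intro y hy hyD
    have hyF : y ∈ F := by
      by_contra h
      exact (hGN' hy).2 ⟨hyD, h⟩
    rw [hG, connectedComponentIn_eq hy]
    exact isPreconnected_connectedComponentIn.subset_connectedComponentIn
      (mem_connectedComponentIn hyD) ((hFcomp y hyF).trans hFN')
  refine ⟨G, hGo, ?_, hGN'.trans sdiff_subset, hGsat, ?_⟩
  · exact isPreconnected_connectedComponentIn.subset_connectedComponentIn
      (mem_connectedComponentIn hx) (hxF.trans hFN')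
  have hFG : IsClosed (F ∩ G) := by
    rw [← isOpen_compl_iff, Metric.isOpen_iff]
    intro p hp
    by_cases hpF : p ∈ F
    · have hpG : p ∉ G := fun h => hp ⟨hpF, h⟩
      have hop : IsOpen (connectedComponentIn N' p) := hN'o.connectedComponentIn
      obtain ⟨ε, hε, hb⟩ := Metric.isOpen_iff.mp hop p (mem_connectedComponentIn (hFN' hpF))
      refine ⟨ε, hε, fun z hz hzFG => hpG ?_⟩
      have := connectedComponentIn_eq_of_mem_of_mem (hb hz) hzFG.2
      rw [hG, ← this]
      exact mem_connectedComponentIn (hFN' hpF)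
    · obtain ⟨ε, hε, hb⟩ := Metric.isOpen_iff.mp hF.isOpen_compl p hpF
      exact ⟨ε, hε, fun z hz h => hb hz h.1⟩
  have hH : IsPreconnected (F ∩ G)ᶜ := by
    refine isPreconnected_union_components hDo hD (fun z hz h => hFD h.1 hz) ?_
    intro y hy hyD z hz hzFG
    apply hy
    have e := connectedComponentIn_eq hz
    have hyz : y ∈ connectedComponentIn Dᶜ z := e ▸ mem_connectedComponentIn hyD
    exact ⟨hFcomp z hzFG.1 hyz, hGsat z hzFG.2 (hFD hzFG.1) hyz⟩
  have hu : G ∪ (F ∩ G)ᶜ = univ := by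
    ext z
    by_cases hz : z ∈ G <;> simp [hz]
  have := isPreconnected_inter_of_union_eq_univ hGo hFG.isOpen_compl
    isPreconnected_connectedComponentIn hH hu
  convert this using 1
  ext z
  constructor
  · rintro ⟨h1, h2⟩
    exact ⟨h1, fun h => hFD h.1 h2⟩
  · rintro ⟨h1, h2⟩
    refine ⟨h1, ?_⟩
    by_contra hzD
    exact (hGN' h1).2 ⟨hzD, fun h => h2 ⟨h, h1⟩⟩

end Domain

/-- Mutually inverse homeomorphisms between bounded planar domains. -/
structure HomeoPair (φ ψ : ℂ → ℂ) (D Ω : Set ℂ) : Prop where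
  isOpen_left : IsOpen D
  isOpen_right : IsOpen Ω
  isConnected_left : IsConnected D
  isConnected_right : IsConnected Ω
  isBounded_left : Bornology.IsBounded D
  isBounded_right : Bornology.IsBounded Ω
  continuousOn_left : ContinuousOn φ D
  continuousOn_right : ContinuousOn ψ Ω
  mapsTo_left : MapsTo φ D Ω
  mapsTo_right : MapsTo ψ Ω D
  leftInvOn : LeftInvOn ψ φ D
  rightInvOn : RightInvOn ψ φ Ω

/-- The closure of the graph of `φ` over `D`. -/
def closedGraph (φ : ℂ → ℂ) (D : Set ℂ) : Set (ℂ × ℂ) :=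
  closure ((fun z => (z, φ z)) '' D)

/-- The singleton of a point of `D`, or the component of the complement of `D`. -/
def cell (D : Set ℂ) (z : ℂ) : Set ℂ :=
  {x | x = z ∨ z ∉ D ∧ x ∈ connectedComponentIn Dᶜ z}

section Cell

variable {D : Set ℂ} {x y z : ℂ}

theorem mem_cell_self (D : Set ℂ) (z : ℂ) : z ∈ cell D z := Or.inl rfl

theorem cell_of_mem (h : z ∈ D) : cell D z = {z} := by
  ext x; simp [cell, h]

theorem cell_of_notMem (h : z ∉ D) : cell D z = connectedComponentIn Dᶜ z := by
  ext x
  simp only [cell, h, not_false_eq_true, true_and, mem_ofPred_eq, or_iff_right_iff_imp]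
  rintro rfl
  exact mem_connectedComponentIn h

theorem cell_subset_compl (h : z ∉ D) : cell D z ⊆ Dᶜ := by
  rw [cell_of_notMem h]
  exact connectedComponentIn_subset _ _

theorem cell_eq (h : x ∈ cell D z) : cell D x = cell D z := by
  rcases h with rfl | ⟨hz, hx⟩
  · rfl
  · have hxD : x ∉ D := connectedComponentIn_subset _ _ hx
    rw [cell_of_notMem hz, cell_of_notMem hxD, connectedComponentIn_eq hx]

theorem cell_eq_of_mem_of_mem (hx : z ∈ cell D x) (hy : z ∈ cell D y) : cell D x = cell D y :=
  (cell_eq hx).symm.trans (cell_eq hy)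

theorem isClosed_cell (hD : IsOpen D) : IsClosed (cell D z) := by
  by_cases h : z ∈ D
  · rw [cell_of_mem h]; exact isClosed_singleton
  · rw [cell_of_notMem h]; exact isClosed_connectedComponentIn hD.isClosed_compl _

theorem isPreconnected_cell : IsPreconnected (cell D z) := by
  by_cases h : z ∈ D
  · rw [cell_of_mem h]; exact isPreconnected_singleton
  · rw [cell_of_notMem h]; exact isPreconnected_connectedComponentIn

theorem exists_mem_cell_closure (hDo : IsOpen D) (hDne : D.Nonempty) (z : ℂ) :
    ∃ y ∈ cell D z, y ∈ closure D := by
  by_cases h : z ∈ D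
  · exact ⟨z, mem_cell_self D z, subset_closure h⟩
  · rw [cell_of_notMem h]
    exact exists_mem_connectedComponentIn_closure hDo hDne h

theorem exists_connected_nhd_cell (hDo : IsOpen D) (hD : IsConnected D)
    (hDb : Bornology.IsBounded D) {N : Set ℂ} (hN : IsOpen N) (hxN : cell D x ⊆ N) :
    ∃ G, IsOpen G ∧ cell D x ⊆ G ∧ G ⊆ N ∧ (∀ y ∈ G, cell D y ⊆ G) ∧
      IsPreconnected (G ∩ D) := by
  by_cases h : x ∈ D
  · obtain ⟨r, hr, hb⟩ := Metric.isOpen_iff.mp (hN.inter hDo) x ⟨hxN (mem_cell_self D x), h⟩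
    refine ⟨ball x r, isOpen_ball, ?_, hb.trans inter_subset_left, ?_, ?_⟩
    · rw [cell_of_mem h]; simpa using hr
    · intro y hy
      rw [cell_of_mem (hb hy).2]
      simpa using hy
    · rw [inter_eq_left.mpr (hb.trans inter_subset_right)]
      exact (convex_ball x r).isPreconnected
  · rw [cell_of_notMem h] at hxN ⊢
    obtain ⟨G, h1, h2, h3, h4, h5⟩ := exists_connected_nhd hDo hD hDb h hN hxN
    refine ⟨G, h1, h2, h3, fun y hy => ?_, h5⟩
    by_cases hyD : y ∈ D
    · rw [cell_of_mem hyD]; simpa using hy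
    · rw [cell_of_notMem hyD]; exact h4 y hy hyD

theorem isOpen_setOf_cell_subset (hDo : IsOpen D) (hD : IsConnected D)
    (hDb : Bornology.IsBounded D) {N : Set ℂ} (hN : IsOpen N) : IsOpen {z | cell D z ⊆ N} := by
  rw [isOpen_iff_mem_nhds]
  intro z hz
  obtain ⟨G, h1, h2, h3, h4, -⟩ := exists_connected_nhd_cell hDo hD hDb hN hz
  filter_upwards [h1.mem_nhds (h2 (mem_cell_self D z))] with y hy
  exact (h4 y hy).trans h3

end Cell

namespace HomeoPair

variable {φ ψ : ℂ → ℂ} {D Ω : Set ℂ} {z w z' w' : ℂ}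

theorem symm (h : HomeoPair φ ψ D Ω) : HomeoPair ψ φ Ω D :=
  ⟨h.2, h.1, h.4, h.3, h.6, h.5, h.8, h.7, h.10, h.9, h.12, h.11⟩

theorem swap_mem (h : HomeoPair φ ψ D Ω) (hp : (z, w) ∈ closedGraph φ D) :
    (w, z) ∈ closedGraph ψ Ω := by
  have := image_closure_subset_closure_image continuous_swap (mem_image_of_mem Prod.swap hp)
  refine closure_mono ?_ this
  rintro _ ⟨_, ⟨x, hx, rfl⟩, rfl⟩
  exact ⟨φ x, h.mapsTo_left hx, by simp [h.leftInvOn hx]⟩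

theorem mem_graph (hz : z ∈ D) : (z, φ z) ∈ closedGraph φ D :=
  subset_closure (mem_image_of_mem _ hz)

theorem isCompact_graph (h : HomeoPair φ ψ D Ω) : IsCompact (closedGraph φ D) := by
  refine Bornology.IsBounded.isCompact_closure ((h.isBounded_left.prod h.isBounded_right).subset ?_)
  rintro _ ⟨x, hx, rfl⟩
  exact ⟨hx, h.mapsTo_left hx⟩

theorem fst_mem_closure (hp : (z, w) ∈ closedGraph φ D) : z ∈ closure D := by
  have := image_closure_subset_closure_image continuous_fst (mem_image_of_mem Prod.fst hp)
  refine closure_mono ?_ this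
  rintro _ ⟨_, ⟨x, hx, rfl⟩, rfl⟩
  exact hx

theorem snd_mem_closure (h : HomeoPair φ ψ D Ω) (hp : (z, w) ∈ closedGraph φ D) :
    w ∈ closure Ω := fst_mem_closure (h.swap_mem hp)

theorem eq_of_mem (h : HomeoPair φ ψ D Ω) (hp : (z, w) ∈ closedGraph φ D) (hz : z ∈ D) :
    w = φ z := by
  by_contra hne
  have hc : ContinuousAt φ z := h.continuousOn_left.continuousAt (h.isOpen_left.mem_nhds hz)
  obtain ⟨u, v, hu, hv, hwu, hzv, huv⟩ := t2_separation hne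
  have hnh : (φ ⁻¹' v) ×ˢ u ∈ 𝓝 (z, w) :=
    prod_mem_nhds (hc (hv.mem_nhds hzv)) (hu.mem_nhds hwu)
  obtain ⟨_, ⟨h1, h2⟩, x, hx, rfl⟩ := mem_closure_iff_nhds.mp hp _ hnh
  exact disjoint_left.mp huv h2 h1

theorem snd_mem (h : HomeoPair φ ψ D Ω) (hp : (z, w) ∈ closedGraph φ D) (hz : z ∈ D) :
    w ∈ Ω := by
  rw [h.eq_of_mem hp hz]; exact h.mapsTo_left hz

theorem mem_iff (h : HomeoPair φ ψ D Ω) (hp : (z, w) ∈ closedGraph φ D) : z ∈ D ↔ w ∈ Ω :=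
  ⟨h.snd_mem hp, h.symm.snd_mem (h.swap_mem hp)⟩

theorem exists_mem_graph (h : HomeoPair φ ψ D Ω) (hz : z ∈ closure D) :
    ∃ w, (z, w) ∈ closedGraph φ D := by
  have hcl : IsClosed (Prod.fst '' closedGraph φ D) :=
    (h.isCompact_graph.image continuous_fst).isClosed
  have hsub : closure D ⊆ Prod.fst '' closedGraph φ D :=
    closure_minimal (fun x hx => ⟨_, mem_graph hx, rfl⟩) hcl
  obtain ⟨⟨_, w⟩, hw, rfl⟩ := hsub hz
  exact ⟨w, hw⟩

/-- Upper semicontinuity of the cluster sets. -/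
theorem isOpen_setOf_forall (h : HomeoPair φ ψ D Ω) {O : Set ℂ} (hO : IsOpen O) :
    IsOpen {z | ∀ w, (z, w) ∈ closedGraph φ D → w ∈ O} := by
  have hc : IsCompact (Prod.fst '' (closedGraph φ D ∩ Prod.snd ⁻¹' Oᶜ)) :=
    (h.isCompact_graph.inter_right (hO.isClosed_compl.preimage continuous_snd)).image
      continuous_fst
  convert hc.isClosed.isOpen_compl using 1
  ext z
  simp only [mem_ofPred_eq, mem_compl_iff, mem_image, mem_inter_iff, mem_preimage, Prod.exists,
    exists_and_right, exists_eq_right, not_exists, not_and, not_not]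

/-- The part of the boundary corresponding to a cell. -/
def clusterCell (φ : ℂ → ℂ) (D : Set ℂ) (z : ℂ) : Set ℂ :=
  {w | ∃ z' ∈ cell D z, (z', w) ∈ closedGraph φ D}

theorem isCompact_clusterCell (h : HomeoPair φ ψ D Ω) : IsCompact (clusterCell φ D z) := by
  have : IsCompact (Prod.snd '' (closedGraph φ D ∩ Prod.fst ⁻¹' (cell D z))) :=
    (h.isCompact_graph.inter_right ((isClosed_cell h.isOpen_left).preimage continuous_fst)).image
      continuous_snd
  convert this using 1
  ext w
  simp only [clusterCell, mem_ofPred_eq, mem_image, mem_inter_iff, mem_preimage, Prod.exists,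
    exists_eq_right]
  simp [and_comm]

theorem isPreconnected_clusterCell (h : HomeoPair φ ψ D Ω) :
    IsPreconnected (clusterCell φ D z) := by
  rw [isPreconnected_iff_subset_of_fully_disjoint_closed h.isCompact_clusterCell.isClosed]
  intro u v hu hv huv hd
  obtain ⟨U, V, hU, hV, huU, hvV, hUV⟩ := normal_separation hu hv hd
  obtain ⟨G, hG, hzG, hGN, -, hGD⟩ := exists_connected_nhd_cell h.isOpen_left h.isConnected_left
    h.isBounded_left (h.isOpen_setOf_forall (hU.union hV)) (x := z)
    (fun x hx w hw => (huv ⟨x, hx, hw⟩).imp (fun h => huU h) (fun h => hvV h))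
  have himg : IsPreconnected (φ '' (G ∩ D)) :=
    hGD.image _ (h.continuousOn_left.mono inter_subset_right)
  have hsub : φ '' (G ∩ D) ⊆ U ∪ V := by
    rintro _ ⟨x, hx, rfl⟩
    exact hGN hx.1 _ (mem_graph hx.2)
  have hcl : clusterCell φ D z ⊆ closure (φ '' (G ∩ D)) := by
    rintro w ⟨x, hx, hxw⟩
    rw [mem_closure_iff_nhds]
    intro t ht
    obtain ⟨_, ⟨h1, h2⟩, y, hy, rfl⟩ := mem_closure_iff_nhds.mp hxw _
      (prod_mem_nhds (hG.mem_nhds (hzG hx)) ht)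
    exact ⟨φ y, h2, y, ⟨h1, hy⟩, rfl⟩
  rcases (isPreconnected_iff_subset_of_disjoint.mp himg) U V hU hV hsub
    (by rw [hUV.inter_eq, inter_empty]) with h1 | h1
  · left
    intro w hw
    refine (huv hw).resolve_right fun hwv => ?_
    exact disjoint_left.mp (hUV.closure_left hV) (closure_mono h1 (hcl hw)) (hvV hwv)
  · right
    intro w hw
    refine (huv hw).resolve_left fun hwv => ?_
    exact disjoint_left.mp (hUV.closure_right hU) (huU hwv) (closure_mono h1 (hcl hw))

theorem clusterCell_nonempty (h : HomeoPair φ ψ D Ω) (z : ℂ) : (clusterCell φ D z).Nonempty := by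
  obtain ⟨y, hy, hyD⟩ := exists_mem_cell_closure h.isOpen_left h.isConnected_left.nonempty z
  obtain ⟨w, hw⟩ := h.exists_mem_graph hyD
  exact ⟨w, y, hy, hw⟩

theorem mem_cell_of_mem_cell (h : HomeoPair φ ψ D Ω) (hp : (z, w) ∈ closedGraph φ D)
    (hp' : (z', w') ∈ closedGraph φ D) (hz : z' ∈ cell D z) : w' ∈ cell Ω w := by
  by_cases hzD : z ∈ D
  · rw [cell_of_mem hzD] at hz
    obtain rfl : z' = z := hz
    rw [h.eq_of_mem hp hzD, h.eq_of_mem hp' hzD]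
    exact mem_cell_self _ _
  · have hw : w ∉ Ω := fun hw => hzD ((h.mem_iff hp).mpr hw)
    rw [cell_of_notMem hw]
    refine h.isPreconnected_clusterCell.subset_connectedComponentIn (x := w)
      ⟨z, mem_cell_self D z, hp⟩ ?_ ⟨z', hz, hp'⟩
    rintro v ⟨x, hx, hxv⟩ hv
    exact cell_subset_compl hzD hx ((h.mem_iff hxv).mpr hv)

theorem clusterCell_eq (h : HomeoPair φ ψ D Ω) (hp : (z, w) ∈ closedGraph φ D) :
    clusterCell φ D z = cell Ω w ∩ closure Ω := by
  ext v
  constructor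
  · rintro ⟨x, hx, hxv⟩
    exact ⟨h.mem_cell_of_mem_cell hp hxv hx, h.snd_mem_closure hxv⟩
  · rintro ⟨hv, hvΩ⟩
    obtain ⟨x, hx⟩ := h.symm.exists_mem_graph hvΩ
    exact ⟨x, h.symm.mem_cell_of_mem_cell (h.swap_mem hp) hx hv, h.symm.swap_mem hx⟩

/-- The correspondence between cells of `D` and cells of `Ω`. -/
def Corr (φ : ℂ → ℂ) (D Ω : Set ℂ) (z w : ℂ) : Prop :=
  ∃ z' ∈ cell D z, ∃ w' ∈ cell Ω w, (z', w') ∈ closedGraph φ D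

theorem Corr.symm (h : HomeoPair φ ψ D Ω) (hc : Corr φ D Ω z w) : Corr ψ Ω D w z := by
  obtain ⟨z', hz, w', hw, hp⟩ := hc
  exact ⟨w', hw, z', hz, h.swap_mem hp⟩

theorem exists_corr_left (h : HomeoPair φ ψ D Ω) (z : ℂ) : ∃ w, Corr φ D Ω z w := by
  obtain ⟨w, z', hz, hp⟩ := h.clusterCell_nonempty z
  exact ⟨w, z', hz, w, mem_cell_self _ _, hp⟩

theorem exists_corr_right (h : HomeoPair φ ψ D Ω) (w : ℂ) : ∃ z, Corr φ D Ω z w := by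
  obtain ⟨z, hz⟩ := h.symm.exists_corr_left w
  exact ⟨z, hz.symm h.symm⟩

theorem Corr.cell_eq_right (h : HomeoPair φ ψ D Ω) (hc : Corr φ D Ω z w)
    (hc' : Corr φ D Ω z' w') (hz : cell D z = cell D z') : cell Ω w = cell Ω w' := by
  obtain ⟨a, ha, b, hb, hp⟩ := hc
  obtain ⟨a', ha', b', hb', hp'⟩ := hc'
  have e : a' ∈ cell D a := by
    rw [cell_eq ha, hz]; exact ha'
  have := h.mem_cell_of_mem_cell hp hp' e
  rw [cell_eq hb] at this
  exact cell_eq_of_mem_of_mem this hb'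

theorem Corr.cell_eq_left (h : HomeoPair φ ψ D Ω) (hc : Corr φ D Ω z w)
    (hc' : Corr φ D Ω z' w') (hw : cell Ω w = cell Ω w') : cell D z = cell D z' :=
  Corr.cell_eq_right h.symm (hc.symm h) (hc'.symm h) hw

/-- The union of the cells of `Ω` corresponding to points of `S`. -/
def corrImage (φ : ℂ → ℂ) (D Ω S : Set ℂ) : Set ℂ := {w | ∃ z ∈ S, Corr φ D Ω z w}

theorem isOpen_corrImage (h : HomeoPair φ ψ D Ω) {S : Set ℂ} (hS : IsOpen S)
    (hsat : ∀ z ∈ S, cell D z ⊆ S) : IsOpen (corrImage φ D Ω S) := by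
  rw [isOpen_iff_mem_nhds]
  rintro w ⟨z, hz, hzw⟩
  obtain ⟨G, hG, hwG, hGN, hGs, -⟩ := exists_connected_nhd_cell h.isOpen_right
    h.isConnected_right h.isBounded_right (h.symm.isOpen_setOf_forall hS) (x := w) (by
      intro v hv y hy
      have : Corr φ D Ω y w := ⟨y, mem_cell_self _ _, v, hv, h.symm.swap_mem hy⟩
      exact hsat z hz (Corr.cell_eq_left h this hzw rfl ▸ mem_cell_self D y))
  filter_upwards [hG.mem_nhds (hwG (mem_cell_self _ _))] with v hv
  obtain ⟨y, hy⟩ := h.exists_corr_right v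
  obtain ⟨y', hy', v', hv', hp⟩ := hy
  exact ⟨y', hGN (hGs v hv hv') y' (h.swap_mem hp), y', mem_cell_self _ _, v', hv', hp⟩

/-- The closed graph relation applied to all cells meeting `S`. -/
def clusterImage (φ : ℂ → ℂ) (D S : Set ℂ) : Set ℂ := {w | ∃ z ∈ S, w ∈ clusterCell φ D z}

theorem isPreconnected_clusterImage (h : HomeoPair φ ψ D Ω) {S : Set ℂ}
    (hS : IsPreconnected S) : IsPreconnected (clusterImage φ D S) := by
  rw [isPreconnected_iff_subset_of_disjoint]
  intro U V hU hV hUV hd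
  have hop : ∀ O, IsOpen O → IsOpen {z | clusterCell φ D z ⊆ O} := by
    intro O hO
    convert isOpen_setOf_cell_subset h.isOpen_left h.isConnected_left h.isBounded_left
      (h.isOpen_setOf_forall hO) using 1
    ext z
    constructor
    · intro hz x hx w hw
      exact hz ⟨x, hx, hw⟩
    · rintro hz w ⟨x, hx, hw⟩
      exact hz hx w hw
  have hsub : ∀ z ∈ S, clusterCell φ D z ⊆ clusterImage φ D S := fun z hz w hw => ⟨z, hz, hw⟩
  have hdich : S ⊆ {z | clusterCell φ D z ⊆ U} ∪ {z | clusterCell φ D z ⊆ V} := by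
    intro z hz
    refine isPreconnected_iff_subset_of_disjoint.mp h.isPreconnected_clusterCell U V hU hV
      ((hsub z hz).trans hUV) ?_
    rw [← subset_empty_iff, ← hd]
    exact inter_subset_inter_left _ (hsub z hz)
  rcases isPreconnected_iff_subset_of_disjoint.mp hS _ _ (hop U hU) (hop V hV) hdich (by
    rw [← subset_empty_iff]
    rintro z ⟨hz, h1, h2⟩
    obtain ⟨w, hw⟩ := h.clusterCell_nonempty z
    have he : w ∈ (∅ : Set ℂ) := hd ▸ ⟨hsub z hz hw, h1 hw, h2 hw⟩
    exact he.elim) with h1 | h1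
  · left
    rintro w ⟨z, hz, hw⟩
    exact h1 hz hw
  · right
    rintro w ⟨z, hz, hw⟩
    exact h1 hz hw

end HomeoPair

theorem connectedComponentIn_frontier {Ω : Set ℂ} (hΩo : IsOpen Ω) (hΩ : IsConnected Ω)
    (hΩb : Bornology.IsBounded Ω) {w : ℂ} (hw : w ∈ frontier Ω) :
    connectedComponentIn (frontier Ω) w = cell Ω w ∩ frontier Ω := by
  have hid : HomeoPair id id Ω Ω := ⟨hΩo, hΩo, hΩ, hΩ, hΩb, hΩb, continuousOn_id, continuousOn_id,
    mapsTo_id _, mapsTo_id _, fun _ _ => rfl, fun _ _ => rfl⟩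
  have hwΩ : w ∉ Ω := fun h => by
    rw [hΩo.frontier_eq] at hw; exact hw.2 h
  have hp : (w, w) ∈ closedGraph id Ω := by
    obtain ⟨v, hv⟩ := hid.exists_mem_graph (frontier_subset_closure hw)
    have hcl : IsClosed {p : ℂ × ℂ | p.1 = p.2} := isClosed_eq continuous_fst continuous_snd
    have : closedGraph id Ω ⊆ {p : ℂ × ℂ | p.1 = p.2} :=
      closure_minimal (by rintro _ ⟨x, -, rfl⟩; rfl) hcl
    have e : w = v := this hv
    rwa [← e] at hv
  have hpre : IsPreconnected (cell Ω w ∩ frontier Ω) := by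
    have := hid.isPreconnected_clusterCell (z := w)
    rw [hid.clusterCell_eq hp] at this
    convert this using 1
    ext v
    rw [hΩo.frontier_eq]
    exact ⟨fun h => ⟨h.1, h.2.1⟩, fun h => ⟨h.1, h.2, cell_subset_compl hwΩ h.1⟩⟩
  apply subset_antisymm
  · refine subset_inter ?_ (connectedComponentIn_subset _ _)
    rw [cell_of_notMem hwΩ]
    apply connectedComponentIn_mono
    rw [hΩo.frontier_eq]
    exact fun v hv => hv.2
  · exact hpre.subset_connectedComponentIn ⟨mem_cell_self _ _, hw⟩ inter_subset_right

theorem IsPlanarDomain.exists_ne {D : Set ℂ} (hD : IsPlanarDomain D) :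
    ∃ x ∈ D, ∃ y ∈ D, x ≠ y := by
  obtain ⟨x, hx⟩ := hD.1
  obtain ⟨ε, hε, hb⟩ := Metric.isOpen_iff.mp hD.2.1 x hx
  refine ⟨x, hx, x + (ε / 2 : ℝ), hb ?_, ?_⟩
  · rw [mem_ball, dist_eq_norm]
    simp [abs_of_pos hε, hε]
  · simp [hε.ne']

theorem IsConformalHomeoOnto.homeoPair {D Ω : Set ℂ} {φ : ℂ → ℂ} (hD : IsPlanarDomain D)
    (hDb : Bornology.IsBounded D) (hΩ : IsPlanarDomain Ω) (hΩb : Bornology.IsBounded Ω)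
    (hφ : IsConformalHomeoOnto φ D Ω) : HomeoPair φ (Function.invFunOn φ D) D Ω := by
  obtain ⟨hd, hbij⟩ := hφ
  have hinv := hbij.invOn_invFunOn
  have hmaps : MapsTo (Function.invFunOn φ D) Ω D := hbij.surjOn.mapsTo_invFunOn
  have hopen : ∀ s ⊆ D, IsOpen s → IsOpen (φ '' s) := by
    refine ((hd.analyticOnNhd hD.2.1).is_constant_or_isOpen hD.2.2.isPreconnected).resolve_left ?_
    rintro ⟨w, hw⟩
    obtain ⟨x, hx, y, hy, hxy⟩ := hD.exists_ne
    exact hxy (hbij.injOn hx hy ((hw x hx).trans (hw y hy).symm))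
  refine ⟨hD.2.1, hΩ.2.1, hD.2.2, hΩ.2.2, hDb, hΩb, hd.continuousOn, ?_, hbij.mapsTo, hmaps,
    hinv.1, hinv.2⟩
  intro w hw
  refine ContinuousAt.continuousWithinAt ?_
  intro t ht
  obtain ⟨u, hut, hu, hwu⟩ := _root_.mem_nhds_iff.mp ht
  refine mem_map.mpr (Filter.mem_of_superset ((hopen (u ∩ D) inter_subset_right
    (hu.inter hD.2.1)).mem_nhds ⟨_, ⟨hwu, hmaps hw⟩, hinv.2 hw⟩) ?_)
  rintro _ ⟨x, hx, rfl⟩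
  rw [mem_preimage, hinv.1 hx.2]
  exact hut hx.1

theorem cell_inter_frontier {D : Set ℂ} (hDo : IsOpen D) {z : ℂ} (hz : z ∉ D) :
    cell D z ∩ frontier D = frontier (cell D z) := by
  rw [(isClosed_cell hDo).frontier_eq, hDo.frontier_eq]
  ext x
  constructor
  · rintro ⟨h1, h2, -⟩
    refine ⟨h1, fun hi => ?_⟩
    obtain ⟨y, hy, hyD⟩ := mem_closure_iff.mp h2 _ isOpen_interior hi
    exact cell_subset_compl hz (interior_subset hy) hyD
  · rintro ⟨h1, h2⟩
    refine ⟨h1, ?_, cell_subset_compl hz h1⟩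
    by_contra hcl
    apply h2
    obtain ⟨ε, hε, hb⟩ := Metric.isOpen_iff.mp isClosed_closure.isOpen_compl x hcl
    refine mem_interior.mpr ⟨ball x ε, ?_, isOpen_ball, mem_ball_self hε⟩
    rw [← cell_eq h1, cell_of_notMem (cell_subset_compl hz h1)]
    exact (convex_ball x ε).isPreconnected.subset_connectedComponentIn (mem_ball_self hε)
      fun y hy hyD => hb hy (subset_closure hyD)

theorem IsCircleDomain.cell_cases {D : Set ℂ} (hD : IsCircleDomain D) {z : ℂ} (hz : z ∉ D) :
    cell D z = {z} ∨ (∃ c : ℂ, ∃ ρ : ℝ, 0 < ρ ∧ cell D z = closedBall c ρ) ∨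
      ∃ c : ℂ, ∃ ρ : ℝ, 0 < ρ ∧ cell D z = (ball c ρ)ᶜ := by
  rw [cell_of_notMem hz]
  by_cases hb : Bornology.IsBounded (connectedComponentIn Dᶜ z)
  · rcases (hD.2.2 z hz).1 hb with h | h
    · exact Or.inl h
    · exact Or.inr (Or.inl h)
  · exact Or.inr (Or.inr ((hD.2.2 z hz).2 hb))

theorem IsCircleDomain.exists_frontier_cell {D : Set ℂ} (hD : IsCircleDomain D) {z : ℂ}
    (hz : z ∉ D) : ∃ c : ℂ, ∃ ρ : ℝ, 0 ≤ ρ ∧ frontier (cell D z) = sphere c ρ := by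
  rcases hD.cell_cases hz with h | ⟨c, ρ, hρ, h⟩ | ⟨c, ρ, hρ, h⟩
  · refine ⟨z, 0, le_rfl, ?_⟩
    rw [h, sphere_zero, isClosed_singleton.frontier_eq, interior_singleton, sdiff_empty]
  · exact ⟨c, ρ, hρ.le, by rw [h, frontier_closedBall _ hρ.ne']⟩
  · exact ⟨c, ρ, hρ.le, by rw [h, frontier_compl, frontier_ball _ hρ.ne']⟩

theorem locallyConnectedSpace_image_Icc {a b : ℝ} (hab : a ≤ b) {f : ℝ → ℂ}
    (hf : ContinuousOn f (Icc a b)) : LocallyConnectedSpace ↥(f '' Icc a b) := by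
  have hI : LocallyConnectedSpace (Icc a b) :=
    (isQuotientMap_projIcc (h := hab)).isCoinducing.locallyConnectedSpace
  let g : Icc a b → f '' Icc a b := fun x => ⟨f x, x, x.2, rfl⟩
  have hg : Continuous g := (continuousOn_iff_continuous_domRestrict.mp hf).subtype_mk _
  have hs : Function.Surjective g := by
    rintro ⟨_, x, hx, rfl⟩
    exact ⟨⟨x, hx⟩, rfl⟩
  exact (hg.isClosedMap.isQuotientMap hg hs).isCoinducing.locallyConnectedSpace

theorem sphere_eq_circleMap_image (c : ℂ) {ρ : ℝ} (hρ : 0 ≤ ρ) :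
    sphere c ρ = circleMap c ρ '' Icc 0 (2 * Real.pi) := by
  apply subset_antisymm
  · rw [← abs_of_nonneg hρ, ← image_circleMap_Ioc c ρ, abs_of_nonneg hρ]
    exact image_mono Ioc_subset_Icc_self
  · rintro _ ⟨θ, -, rfl⟩
    exact circleMap_mem_sphere c hρ θ

theorem finite_components_of_tsum {K : Set ℂ}
    (hdiam : ∑' Q : ↥(NondegComponents K), Metric.ediam (Q : Set ℂ) < ⊤) {C : ℝ} (hC : 0 < C) :
    {Q : Set ℂ | (∃ x ∈ K, Q = connectedComponentIn K x) ∧ C < Metric.diam Q}.Finite := by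
  have h := ENNReal.finite_const_le_of_tsum_ne_top hdiam.ne
    (ε := ENNReal.ofReal C) (by simpa using hC)
  refine (h.image (fun Q : ↥(NondegComponents K) => (Q : Set ℂ))).subset ?_
  rintro Q ⟨⟨x, hx, rfl⟩, hQ⟩
  have hnt : (connectedComponentIn K x).Nontrivial := by
    by_contra hn
    rw [not_nontrivial_iff] at hn
    rw [Metric.diam_subsingleton hn] at hQ
    exact lt_asymm hC hQ
  refine ⟨⟨connectedComponentIn K x, ⟨x, hx, rfl⟩, hnt⟩, ?_, rfl⟩
  exact ENNReal.ofReal_le_of_le_toReal hQ.le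

theorem mem_graph_iff_of_extends {φ φb : ℂ → ℂ} {D Ω : Set ℂ}
    (he : ExtendsContinuously φ φb D Ω) {z w : ℂ} (hp : (z, w) ∈ closedGraph φ D) :
    z ∈ closure D ∧ w = φb z := by
  have hz : z ∈ closure D := HomeoPair.fst_mem_closure hp
  refine ⟨hz, ?_⟩
  by_contra hne
  obtain ⟨u, v, hu, hv, hwu, hzv, huv⟩ := t2_separation hne
  obtain ⟨o, ho, hoD⟩ := mem_nhdsWithin_iff_exists_mem_nhds_inter.mp
    (he.1 z hz (hv.mem_nhds hzv))
  obtain ⟨_, ⟨h1, h2⟩, x, hx, rfl⟩ := mem_closure_iff_nhds.mp hp _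
    (prod_mem_nhds ho (hu.mem_nhds hwu))
  refine disjoint_left.mp huv h2 ?_
  change φ x ∈ v
  rw [← he.2.1 hx]
  exact hoD ⟨h1, subset_closure hx⟩

theorem inter_frontier_eq_inter_closure {Ω A : Set ℂ} (hΩ : IsOpen Ω) (hA : A ⊆ Ωᶜ) :
    A ∩ frontier Ω = A ∩ closure Ω := by
  ext v
  rw [hΩ.frontier_eq]
  exact ⟨fun h => ⟨h.1, h.2.1⟩, fun h => ⟨h.1, h.2, hA h.1⟩⟩

theorem HomeoPair.clusterCell_eq_component {D Ω : Set ℂ} {φ ψ : ℂ → ℂ} {z w : ℂ}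
    (h : HomeoPair φ ψ D Ω) (hz : z ∉ D) (hw : w ∈ clusterCell φ D z) :
    w ∈ frontier Ω ∧ clusterCell φ D z = connectedComponentIn (frontier Ω) w := by
  obtain ⟨x, hx, hxw⟩ := hw
  have hwΩ : w ∉ Ω := fun h' => cell_subset_compl hz hx ((h.mem_iff hxw).mpr h')
  have hwf : w ∈ frontier Ω := by
    rw [h.isOpen_right.frontier_eq]
    exact ⟨h.snd_mem_closure hxw, hwΩ⟩
  refine ⟨hwf, ?_⟩
  rw [connectedComponentIn_frontier h.isOpen_right h.isConnected_right h.isBounded_right hwf,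
    inter_frontier_eq_inter_closure h.isOpen_right (cell_subset_compl hwΩ), ← h.clusterCell_eq hxw]
  simp only [clusterCell, cell_eq hx]

theorem isPeanoCompactum_of_extends {D Ω : Set ℂ} {φ ψ φb : ℂ → ℂ} (h : HomeoPair φ ψ D Ω)
    (hD : IsCircleDomain D)
    (hdiam : ∑' Q : ↥(NondegComponents (frontier Ω)), Metric.ediam (Q : Set ℂ) < ⊤)
    (he : ExtendsContinuously φ φb D Ω) : IsPeanoCompactum (frontier Ω) := by
  have hb : Bornology.IsBounded (frontier Ω) :=
    h.isBounded_right.closure.subset frontier_subset_closure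
  refine ⟨Metric.isCompact_of_isClosed_isBounded isClosed_frontier hb, fun w hw => ?_,
    fun C hC => finite_components_of_tsum hdiam hC⟩
  obtain ⟨z, hz⟩ := h.symm.exists_mem_graph (frontier_subset_closure hw)
  have hp := h.symm.swap_mem hz
  have hwΩ : w ∉ Ω := by
    rw [h.isOpen_right.frontier_eq] at hw; exact hw.2
  have hzD : z ∉ D := fun hzD => hwΩ ((h.mem_iff hp).mp hzD)
  obtain ⟨c, ρ, hρ, hc⟩ := hD.exists_frontier_cell hzD
  have hfr : frontier D ⊆ closure D := frontier_subset_closure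
  have key : connectedComponentIn (frontier Ω) w =
      (φb ∘ circleMap c ρ) '' Icc 0 (2 * Real.pi) := by
    rw [← (h.clusterCell_eq_component hzD ⟨z, mem_cell_self _ _, hp⟩).2, image_comp,
      ← sphere_eq_circleMap_image c hρ, ← hc, ← cell_inter_frontier h.isOpen_left hzD]
    ext v
    constructor
    · rintro ⟨x, hx, hxv⟩
      obtain ⟨h1, h2⟩ := mem_graph_iff_of_extends he hxv
      refine ⟨x, ⟨hx, ?_⟩, h2.symm⟩
      rw [h.isOpen_left.frontier_eq]
      exact ⟨h1, cell_subset_compl hzD hx⟩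
    · rintro ⟨x, ⟨hx, hxD⟩, rfl⟩
      obtain ⟨v, hv⟩ := h.exists_mem_graph (hfr hxD)
      have := (mem_graph_iff_of_extends he hv).2
      exact ⟨x, hx, this ▸ hv⟩
  rw [key]
  refine locallyConnectedSpace_image_Icc (by positivity) ?_
  refine he.1.comp (continuous_circleMap c ρ).continuousOn fun θ _ => ?_
  apply hfr
  have : circleMap c ρ θ ∈ cell D z ∩ frontier D := by
    rw [cell_inter_frontier h.isOpen_left hzD, hc]
    exact circleMap_mem_sphere c hρ θ
  exact this.2

theorem isPreconnected_sphere_inter_halfplane (z₀ : ℂ) {r : ℝ} (hr : 0 ≤ r) (u : ℂ) (t : ℝ) :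
    IsPreconnected {z | z ∈ sphere z₀ r ∧ t < (u * (z - z₀)).re} := by
  have hJ : ({θ | θ ∈ Icc (-Real.pi) Real.pi ∧ t < ‖u‖ * r * Real.cos θ} : Set ℝ).OrdConnected := by
    refine ⟨?_⟩
    rintro a ⟨ha, hat⟩ b ⟨hb, hbt⟩ x hx
    have hx' : x ∈ Icc (-Real.pi) Real.pi := ⟨ha.1.trans hx.1, hx.2.trans hb.2⟩
    refine ⟨hx', ?_⟩
    have hn : 0 ≤ ‖u‖ * r := by positivity
    have key : ∀ y ∈ Icc (-Real.pi) Real.pi, |x| ≤ |y| → Real.cos y ≤ Real.cos x := by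
      intro y hy hxy
      rw [← Real.cos_abs x, ← Real.cos_abs y]
      exact Real.cos_le_cos_of_nonneg_of_le_pi (abs_nonneg _) (abs_le.mpr hy) hxy
    rcases le_total 0 x with h0 | h0
    · have := key b hb (by rw [abs_of_nonneg h0, abs_of_nonneg (h0.trans hx.2)]; exact hx.2)
      exact hbt.trans_le (mul_le_mul_of_nonneg_left this hn)
    · have := key a ha (by
        rw [abs_of_nonpos h0, abs_of_nonpos (hx.1.trans h0)]; linarith [hx.1])
      exact hat.trans_le (mul_le_mul_of_nonneg_left this hn)
  set β := u.arg
  have hu : (‖u‖ : ℂ) * Complex.exp (β * Complex.I) = u := Complex.norm_mul_exp_arg_mul_I u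
  have hval : ∀ θ : ℝ, (u * (circleMap z₀ r (θ - β) - z₀)).re = ‖u‖ * r * Real.cos θ := by
    intro θ
    have : u * (circleMap z₀ r (θ - β) - z₀) =
        ((‖u‖ * r : ℝ) : ℂ) * Complex.exp (θ * Complex.I) := by
      rw [circleMap, add_sub_cancel_left]
      nth_rewrite 1 [← hu]
      rw [show (‖u‖ : ℂ) * Complex.exp (β * Complex.I) *
        (r * Complex.exp (((θ - β : ℝ) : ℂ) * Complex.I)) = ((‖u‖ * r : ℝ) : ℂ) *
          (Complex.exp (β * Complex.I) * Complex.exp (((θ - β : ℝ) : ℂ) * Complex.I)) by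
          push_cast; ring, ← Complex.exp_add]
      congr 2
      push_cast; ring
    rw [this, Complex.re_ofReal_mul, Complex.exp_ofReal_mul_I_re]
  have himg := hJ.isPreconnected.image (fun θ => circleMap z₀ r (θ - β))
    ((continuous_circleMap z₀ r).comp (continuous_id.sub continuous_const)).continuousOn
  convert himg using 1
  ext z
  constructor
  · rintro ⟨hz, ht⟩
    have hz' : ‖z - z₀‖ = r := by rwa [← dist_eq_norm]
    set w := (z - z₀) * Complex.exp (β * Complex.I) with hw
    have hwn : ‖w‖ = r := by rw [hw, norm_mul, Complex.norm_exp_ofReal_mul_I, mul_one, hz']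
    have hwe := Complex.norm_mul_exp_arg_mul_I w
    have hz2 : circleMap z₀ r (w.arg - β) = z := by
      rw [circleMap, Complex.ofReal_sub, sub_mul, Complex.exp_sub, ← mul_div_assoc]
      nth_rewrite 1 [← hwn]
      rw [hwe, hw, mul_div_assoc, div_self (Complex.exp_ne_zero _)]
      ring
    refine ⟨w.arg, ⟨⟨(Complex.neg_pi_lt_arg w).le, Complex.arg_le_pi w⟩, ?_⟩, hz2⟩
    rw [← hval, hz2]; exact ht
  · rintro ⟨θ, ⟨-, hθ⟩, rfl⟩
    refine ⟨circleMap_mem_sphere z₀ hr _, ?_⟩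
    rw [hval]; exact hθ

theorem norm_sq_sub_eq (z z₀ c : ℂ) : ‖z - c‖ ^ 2 =
    ‖z - z₀‖ ^ 2 + ‖z₀ - c‖ ^ 2 + 2 * ((starRingEnd ℂ (z₀ - c)) * (z - z₀)).re := by
  simp only [← Complex.normSq_eq_norm_sq, Complex.normSq_apply, Complex.mul_re, Complex.conj_re,
    Complex.conj_im, Complex.sub_re, Complex.sub_im]
  ring

theorem IsCircleDomain.isPreconnected_sphere_sdiff {D : Set ℂ} (hD : IsCircleDomain D) {z₀ : ℂ}
    (hz : z₀ ∈ frontier D) {r : ℝ} (hr : 0 < r) :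
    IsPreconnected (sphere z₀ r \ cell D z₀) := by
  have hzD : z₀ ∉ D := by
    rw [hD.1.2.1.frontier_eq] at hz; exact hz.2
  have hzf : z₀ ∈ frontier (cell D z₀) := by
    rw [← cell_inter_frontier hD.1.2.1 hzD]
    exact ⟨mem_cell_self _ _, hz⟩
  rcases hD.cell_cases hzD with h | ⟨c, ρ, hρ, h⟩ | ⟨c, ρ, hρ, h⟩
  · convert isPreconnected_sphere_inter_halfplane z₀ hr.le 0 (-1) using 1
    ext z
    rw [h]
    constructor
    · rintro ⟨h1, -⟩
      exact ⟨h1, by simp⟩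
    · rintro ⟨h1, -⟩
      exact ⟨h1, fun h2 => ne_of_mem_sphere h1 hr.ne' h2⟩
  · rw [h, frontier_closedBall _ hρ.ne'] at hzf
    have hzc : ‖z₀ - c‖ = ρ := by rwa [← dist_eq_norm]
    convert isPreconnected_sphere_inter_halfplane z₀ hr.le (starRingEnd ℂ (z₀ - c)) (-r ^ 2 / 2)
      using 1
    ext z
    rw [h, Set.mem_sdiff, mem_closedBall, not_le, dist_eq_norm, mem_ofPred_eq]
    refine and_congr_right fun h1 => ?_
    have h2 : ‖z - z₀‖ = r := by rwa [← dist_eq_norm]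
    have := norm_sq_sub_eq z z₀ c
    rw [h2, hzc] at this
    rw [← sq_lt_sq₀ hρ.le (norm_nonneg _), this]
    constructor <;> intro <;> linarith
  · rw [h, frontier_compl, frontier_ball _ hρ.ne'] at hzf
    have hzc : ‖z₀ - c‖ = ρ := by rwa [← dist_eq_norm]
    convert isPreconnected_sphere_inter_halfplane z₀ hr.le (-(starRingEnd ℂ (z₀ - c))) (r ^ 2 / 2)
      using 1
    ext z
    rw [h, Set.mem_sdiff, notMem_compl_iff, mem_ball, dist_eq_norm, mem_ofPred_eq]
    refine and_congr_right fun h1 => ?_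
    have h2 : ‖z - z₀‖ = r := by rwa [← dist_eq_norm]
    have := norm_sq_sub_eq z z₀ c
    rw [h2, hzc] at this
    rw [← sq_lt_sq₀ (norm_nonneg _) hρ.le, this, neg_mul, Complex.neg_re]
    constructor <;> intro <;> linarith

theorem exists_interval_cover {E : Set ℂ} (hE : μH[1] E < ⊤) (z₀ : ℂ) (n : ℕ) :
    ∃ t : ℕ → Set ℂ, ∃ I : ℕ → Set ℝ, E ⊆ ⋃ i, t i ∧
      (∀ i, ediam (t i) ≤ ((n : ENNReal) + 1)⁻¹) ∧ (∀ i, MeasurableSet (I i)) ∧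
      (∀ i, ∀ z ∈ t i, dist z z₀ ∈ I i) ∧ ∑' i, volume (I i) ≤ 2 * (μH[1] E + 1) := by
  have hpos : (0 : ENNReal) < ((n : ENNReal) + 1)⁻¹ := by
    rw [ENNReal.inv_pos]; finiteness
  have hlt : (⨅ (t : ℕ → Set ℂ) (_ : E ⊆ ⋃ i, t i) (_ : ∀ i, ediam (t i) ≤ ((n : ENNReal) + 1)⁻¹),
      ∑' i, ⨆ _ : (t i).Nonempty, ediam (t i) ^ (1 : ℝ)) < μH[1] E + 1 := by
    refine lt_of_le_of_lt ?_ (ENNReal.lt_add_right hE.ne one_ne_zero)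
    rw [Measure.hausdorffMeasure_apply]
    exact le_iSup₂_of_le _ hpos le_rfl
  simp only [iInf_lt_iff] at hlt
  obtain ⟨t, ht, hd, hs⟩ := hlt
  have hex : ∀ i, ∃ I : Set ℝ, MeasurableSet I ∧ (∀ z ∈ t i, dist z z₀ ∈ I) ∧
      volume I ≤ 2 * ⨆ _ : (t i).Nonempty, ediam (t i) ^ (1 : ℝ) := by
    intro i
    rcases (t i).eq_empty_or_nonempty with h | ⟨p, hp⟩
    · exact ⟨∅, MeasurableSet.empty, by simp [h], by simp⟩
    · refine ⟨closedEBall (dist p z₀) (ediam (t i)), isClosed_closedEBall.measurableSet, ?_, ?_⟩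
      · intro z hz
        rw [mem_closedEBall]
        refine le_trans ?_ (edist_le_ediam_of_mem hz hp)
        rw [edist_dist, edist_dist]
        exact ENNReal.ofReal_le_ofReal (abs_dist_sub_le z p z₀)
      · simp only [show (t i).Nonempty from ⟨p, hp⟩, iSup_pos, ENNReal.rpow_one]
        exact (Real.volume_closedEBall _ _).le
  choose I hI1 hI2 hI3 using hex
  refine ⟨t, I, ht, hd, hI1, hI2, ?_⟩
  calc ∑' i, volume (I i) ≤ ∑' i, 2 * ⨆ _ : (t i).Nonempty, ediam (t i) ^ (1 : ℝ) :=
        ENNReal.tsum_le_tsum hI3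
    _ = 2 * ∑' i, ⨆ _ : (t i).Nonempty, ediam (t i) ^ (1 : ℝ) := ENNReal.tsum_mul_left
    _ ≤ _ := mul_le_mul_right hs.le 2

/-- Almost every circle around a point meets a set of finite linear measure in a finite set. -/
theorem ae_finite_inter_sphere {E : Set ℂ} (hE : μH[1] E < ⊤) (z₀ : ℂ) :
    ∀ᵐ r : ℝ, (E ∩ sphere z₀ r).Finite := by
  choose t I ht hd hm hI hs using exists_interval_cover hE z₀
  set g : ℕ → ℝ → ENNReal := fun n r => ∑' i, (I n i).indicator 1 r with hg
  have hgm : ∀ n, Measurable (g n) := fun n =>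
    Measurable.tsum fun i => measurable_one.indicator (hm n i)
  have hgi : ∀ n, ∫⁻ r, g n r ≤ 2 * (μH[1] E + 1) := by
    intro n
    rw [hg, lintegral_tsum fun i => (measurable_one.indicator (hm n i)).aemeasurable]
    refine le_trans (ENNReal.tsum_le_tsum fun i => ?_) (hs n)
    rw [lintegral_indicator_one (hm n i)]
  have hfin : ∫⁻ r, liminf (fun n => g n r) atTop ≠ ⊤ := by
    refine ne_top_of_le_ne_top ?_ ((lintegral_liminf_le hgm).trans
      (liminf_le_of_le (a := 2 * (μH[1] E + 1)) (by isBoundedDefault) fun b hb => ?_))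
    · have := hE.ne
      finiteness
    · obtain ⟨n, hn⟩ := hb.exists
      exact hn.trans (hgi n)
  have hmeas : Measurable fun r => liminf (fun n => g n r) atTop := Measurable.liminf hgm
  filter_upwards [ae_lt_top hmeas hfin] with r hr
  by_contra hinf
  apply hr.ne
  rw [eq_top_iff, ← ENNReal.iSup_natCast]
  refine iSup_le fun k => ?_
  obtain ⟨s, hsE, hsk⟩ := Set.Infinite.exists_subset_card_eq hinf k
  have hsep : ∃ η : ENNReal, 0 < η ∧ ∀ x ∈ s, ∀ y ∈ s, x ≠ y → η ≤ edist x y := by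
    refine ⟨s.inf fun x => s.inf fun y => if x = y then ⊤ else edist x y, ?_, ?_⟩
    · rw [Finset.lt_inf_iff (by simp)]
      intro x _
      rw [Finset.lt_inf_iff (by simp)]
      intro y _
      split_ifs with h
      · simp
      · exact edist_pos.mpr h
    · intro x hx y hy hxy
      refine (Finset.inf_le hx).trans ((Finset.inf_le hy).trans ?_)
      simp [hxy]
  obtain ⟨η, hη, hsep⟩ := hsep
  refine le_liminf_of_le (by isBoundedDefault) ?_
  have hev : ∀ᶠ n : ℕ in atTop, ((n : ENNReal) + 1)⁻¹ < η := by
    have h1 : Tendsto (fun n : ℕ => ((n + 1 : ℕ) : ENNReal)⁻¹) atTop (𝓝 0) :=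
      ENNReal.tendsto_inv_nat_nhds_zero.comp (tendsto_add_atTop_nat 1)
    filter_upwards [h1.eventually (gt_mem_nhds hη)] with n hn
    simpa using hn
  filter_upwards [hev] with n hn
  have hcov : ∀ x ∈ s, ∃ i, x ∈ t n i := fun x hx => mem_iUnion.mp (ht n (hsE hx).1)
  choose! c hc using hcov
  have hinj : Set.InjOn c s := by
    intro x hx y hy hxy
    by_contra hne
    have h1 := edist_le_ediam_of_mem (hc x hx) (hxy ▸ hc y hy)
    exact absurd ((hsep x hx y hy hne).trans (h1.trans (hd n _))) (not_le.mpr hn)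
  calc (k : ENNReal) = ∑ i ∈ s.image c, (I n i).indicator 1 r := by
        rw [Finset.sum_image hinj, ← hsk, Finset.card_eq_sum_ones, Nat.cast_sum]
        refine Finset.sum_congr rfl fun x hx => ?_
        have hxr : dist x z₀ = r := (hsE hx).2
        rw [indicator_of_mem (hxr ▸ hI n _ x (hc x hx))]
        simp
    _ ≤ g n r := ENNReal.sum_le_tsum _

theorem SigmaFiniteH1.ae_countable_inter_sphere {E : Set ℂ} (hE : SigmaFiniteH1 E) (z₀ : ℂ) :
    ∀ᵐ r : ℝ, (E ∩ sphere z₀ r).Countable := by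
  obtain ⟨f, rfl, hf⟩ := hE
  filter_upwards [ae_all_iff.mpr fun n => ae_finite_inter_sphere (hf n) z₀] with r hr
  rw [iUnion_inter]
  exact countable_iUnion fun n => (hr n).countable

theorem lintegral_polar (z₀ : ℂ) {F : ℂ → ENNReal} (hF : Measurable F) :
    ∫⁻ r in Ioi (0 : ℝ), ∫⁻ θ in Ioo (-Real.pi) Real.pi,
      ENNReal.ofReal r * F (circleMap z₀ r θ) = ∫⁻ z, F z := by
  rw [← lintegral_add_left_eq_self F z₀, ← Complex.lintegral_comp_polarCoord_symm,
    polarCoord_target, Measure.volume_eq_prod, ← Measure.prod_restrict, lintegral_prod]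
  · refine lintegral_congr fun r => lintegral_congr fun θ => ?_
    rw [Complex.polarCoord_symm_apply, smul_eq_mul, circleMap, Complex.exp_mul_I]
    push_cast
    rfl
  · refine Measurable.aemeasurable ?_
    have hc : Continuous fun p : ℝ × ℝ => z₀ + (Complex.polarCoord.symm p) := by
      simp only [Complex.polarCoord_symm_apply]
      fun_prop
    simp only [smul_eq_mul]
    exact (ENNReal.measurable_ofReal.comp measurable_fst).mul (hF.comp hc.measurable)

theorem lintegral_inv_Ioo_eq_top {δ : ℝ} (hδ : 0 < δ) {c : ℝ} (hc : 0 < c) :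
    ∫⁻ r in Ioo 0 δ, ENNReal.ofReal (c * r⁻¹) = ⊤ := by
  by_contra h
  have h1 : IntegrableOn (fun r : ℝ => c * r⁻¹) (Ioo 0 δ) := by
    refine ⟨(measurable_inv.const_mul c).aestronglyMeasurable, ?_⟩
    rw [hasFiniteIntegral_iff_ofReal]
    · exact lt_top_iff_ne_top.mpr h
    · filter_upwards [ae_restrict_mem measurableSet_Ioo] with r hr
      have := hr.1
      simp only [Pi.zero_apply]
      positivity
  have h2 : IntegrableOn (fun r : ℝ => r⁻¹) (Ioc 0 δ) := by
    rw [integrableOn_Ioc_iff_integrableOn_Ioo]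
    refine IntegrableOn.congr_fun (h1.const_mul c⁻¹) (fun r _ => ?_) measurableSet_Ioo
    simp [hc.ne']
  rw [← intervalIntegrable_iff_integrableOn_Ioc_of_le hδ.le, intervalIntegrable_inv_iff] at h2
  rcases h2 with h2 | h2
  · exact hδ.ne h2
  · exact h2 left_mem_uIcc

/-- The length–area principle: some circle of small radius has small weighted length. -/
theorem exists_short_circle (z₀ : ℂ) {F : ℂ → ENNReal} (hF : Measurable F)
    (hfin : ∫⁻ z, F z ^ 2 ≠ ⊤) {ε δ : ℝ} (hε : 0 < ε) (hδ : 0 < δ) {P : ℝ → Prop}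
    (hP : ∀ᵐ r : ℝ, P r) :
    ∃ r ∈ Ioo 0 δ, P r ∧
      ∫⁻ θ in Ioo (-Real.pi) Real.pi, ENNReal.ofReal r * F (circleMap z₀ r θ) <
        ENNReal.ofReal ε := by
  by_contra! hcon
  set a : ENNReal := ENNReal.ofReal (ε / (4 * Real.pi)) with ha
  have ha0 : a ≠ 0 := by
    rw [ha, ne_eq, ENNReal.ofReal_eq_zero, not_le]; positivity
  have hat : a ≠ ⊤ := ENNReal.ofReal_ne_top
  have hkey : ∀ r ∈ Ioo 0 δ, P r → ENNReal.ofReal (ε / 2 * r⁻¹) ≤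
      a⁻¹ * ∫⁻ θ in Ioo (-Real.pi) Real.pi, ENNReal.ofReal r * F (circleMap z₀ r θ) ^ 2 := by
    intro r hr hPr
    have hr0 : (0 : ℝ) < r := hr.1
    have hFm : Measurable fun θ => F (circleMap z₀ r θ) :=
      hF.comp (continuous_circleMap z₀ r).measurable
    have hpt : ∀ x : ENNReal, x ≤ a + a⁻¹ * x ^ 2 := by
      intro x
      rcases le_total x a with h | h
      · exact h.trans le_self_add
      · refine le_trans ?_ le_add_self
        calc x = a⁻¹ * a * x := by rw [ENNReal.inv_mul_cancel ha0 hat, one_mul]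
          _ ≤ a⁻¹ * x * x := by gcongr
          _ = a⁻¹ * x ^ 2 := by ring
    have h1 := (hcon r hr hPr).trans (lintegral_mono fun θ => hpt _)
    rw [lintegral_add_left measurable_const, lintegral_const, Measure.restrict_apply_univ,
      Real.volume_Ioo, lintegral_const_mul _ ((hFm.const_mul _).pow_const 2), ha,
      ← ENNReal.ofReal_mul (by positivity)] at h1
    have e1 : ε / (4 * Real.pi) * (Real.pi - -Real.pi) = ε / 2 := by
      field_simp; ring
    rw [e1, ← ha] at h1
    have e2 : ENNReal.ofReal ε = ENNReal.ofReal (ε / 2) + ENNReal.ofReal (ε / 2) := by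
      rw [← ENNReal.ofReal_add (by positivity) (by positivity)]; ring_nf
    rw [e2, ENNReal.add_le_add_iff_left ENNReal.ofReal_ne_top] at h1
    have hri : ENNReal.ofReal r⁻¹ * ENNReal.ofReal r = 1 := by
      rw [← ENNReal.ofReal_mul (by positivity), inv_mul_cancel₀ hr0.ne', ENNReal.ofReal_one]
    calc ENNReal.ofReal (ε / 2 * r⁻¹) = ENNReal.ofReal r⁻¹ * ENNReal.ofReal (ε / 2) := by
          rw [← ENNReal.ofReal_mul (by positivity), mul_comm]
      _ ≤ ENNReal.ofReal r⁻¹ * (a⁻¹ * ∫⁻ θ in Ioo (-Real.pi) Real.pi,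
          (ENNReal.ofReal r * F (circleMap z₀ r θ)) ^ 2) := by gcongr
      _ = a⁻¹ * ∫⁻ θ in Ioo (-Real.pi) Real.pi, ENNReal.ofReal r * F (circleMap z₀ r θ) ^ 2 := by
          rw [mul_left_comm, ← lintegral_const_mul _ ((hFm.const_mul _).pow_const 2)]
          congr 1
          refine lintegral_congr fun θ => ?_
          calc _ = ENNReal.ofReal r⁻¹ * ENNReal.ofReal r *
              (ENNReal.ofReal r * F (circleMap z₀ r θ) ^ 2) := by ring
            _ = _ := by rw [hri, one_mul]
  have h2 : (⊤ : ENNReal) ≤ a⁻¹ * ∫⁻ z, F z ^ 2 := by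
    rw [← lintegral_inv_Ioo_eq_top hδ (half_pos hε), ← lintegral_polar z₀ (hF.pow_const 2)]
    calc _ ≤ ∫⁻ r in Ioo 0 δ, a⁻¹ * ∫⁻ θ in Ioo (-Real.pi) Real.pi,
          ENNReal.ofReal r * F (circleMap z₀ r θ) ^ 2 := by
          refine lintegral_mono_ae ?_
          filter_upwards [ae_restrict_mem measurableSet_Ioo, ae_restrict_of_ae hP] with r hr hPr
          exact hkey r hr hPr
      _ = a⁻¹ * ∫⁻ r in Ioo 0 δ, ∫⁻ θ in Ioo (-Real.pi) Real.pi,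
          ENNReal.ofReal r * F (circleMap z₀ r θ) ^ 2 :=
          lintegral_const_mul' _ _ (ENNReal.inv_ne_top.mpr ha0)
      _ ≤ _ := by
          gcongr
          exact Ioo_subset_Ioi_self
  exact (ENNReal.mul_ne_top (ENNReal.inv_ne_top.mpr ha0) hfin) (top_le_iff.mp h2)

/-- The density `|φ'|` on `D`, extended by zero. -/
def speed (φ : ℂ → ℂ) (D : Set ℂ) : ℂ → ENNReal := D.indicator fun z => ‖deriv φ z‖ₑ

theorem measurable_speed (φ : ℂ → ℂ) {D : Set ℂ} (hD : IsOpen D) : Measurable (speed φ D) :=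
  (measurable_deriv φ).enorm.indicator hD.measurableSet

theorem lintegral_speed_sq {φ : ℂ → ℂ} {D Ω : Set ℂ} (hD : IsOpen D)
    (hφ : IsConformalHomeoOnto φ D Ω) : ∫⁻ z, speed φ D z ^ 2 = volume Ω := by
  have h := lintegral_abs_det_fderiv_eq_addHaar_image volume hD.measurableSet (f := φ)
    (f' := fun z => (ContinuousLinearMap.toSpanSingleton ℂ (deriv φ z)).restrictScalars ℝ)
    (fun z hz => (((hφ.1.differentiableAt (hD.mem_nhds hz)).hasDerivAt.hasFDerivAt).restrictScalars
      ℝ).hasFDerivWithinAt) hφ.2.injOn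
  rw [hφ.2.image_eq] at h
  rw [← h, ← lintegral_indicator hD.measurableSet]
  refine lintegral_congr fun z => ?_
  by_cases hz : z ∈ D
  · rw [speed, indicator_of_mem hz, indicator_of_mem hz]
    have hdet : ((ContinuousLinearMap.toSpanSingleton ℂ (deriv φ z)).restrictScalars ℝ).det =
        Complex.normSq (deriv φ z) := by
      rw [← Algebra.norm_complex_apply]
      nth_rewrite 2 [← ContinuousLinearMap.det_toSpanSingleton (deriv φ z)]
      exact LinearMap.det_restrictScalars
    rw [hdet]
    simp [Complex.normSq_eq_norm_sq, ENNReal.ofReal_pow]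
  · rw [speed, indicator_of_notMem hz, indicator_of_notMem hz]; simp

theorem volume_projection_circle_le {φ : ℂ → ℂ} {D : Set ℂ} (hD : IsOpen D)
    (hφ : DifferentiableOn ℂ φ D) (z₀ : ℂ) {r : ℝ} (hr : 0 < r) {u : ℂ} (hu : ‖u‖ = 1) :
    volume ((fun w => (u * w).re) '' (φ '' (D ∩ sphere z₀ r))) ≤
      ∫⁻ θ in Ioo (-Real.pi) Real.pi, ENNReal.ofReal r * speed φ D (circleMap z₀ r θ) := by
  set J : Set ℝ := Ioc (-Real.pi) Real.pi ∩ circleMap z₀ r ⁻¹' D with hJ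
  have hJm : MeasurableSet J :=
    measurableSet_Ioc.inter (hD.preimage (continuous_circleMap z₀ r)).measurableSet
  have hsub : (fun w => (u * w).re) '' (φ '' (D ∩ sphere z₀ r)) ⊆
      (fun θ => (u * φ (circleMap z₀ r θ)).re) '' J := by
    rintro _ ⟨_, ⟨z, ⟨hzD, hz⟩, rfl⟩, rfl⟩
    have hz' : ‖z - z₀‖ = r := by rwa [← dist_eq_norm]
    have e : circleMap z₀ r (z - z₀).arg = z := by
      rw [circleMap]
      nth_rewrite 1 [← hz']
      rw [Complex.norm_mul_exp_arg_mul_I]; ring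
    refine ⟨(z - z₀).arg, ⟨⟨Complex.neg_pi_lt_arg _, Complex.arg_le_pi _⟩, ?_⟩, ?_⟩
    · rw [mem_preimage, e]; exact hzD
    · simp only [e]
  have hder : ∀ θ ∈ J, HasFDerivWithinAt (fun θ => (u * φ (circleMap z₀ r θ)).re)
      (ContinuousLinearMap.toSpanSingleton ℝ
        (u * (deriv φ (circleMap z₀ r θ) * (circleMap 0 r θ * Complex.I))).re) J θ := by
    intro θ hθ
    have h1 : HasDerivAt φ (deriv φ (circleMap z₀ r θ)) (circleMap z₀ r θ) :=
      (hφ.differentiableAt (hD.mem_nhds hθ.2)).hasDerivAt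
    have h2 := (h1.comp θ (hasDerivAt_circleMap z₀ r θ)).const_mul u
    have h3 := (Complex.reCLM.hasFDerivAt.comp_hasDerivAt θ h2)
    exact h3.hasFDerivAt.hasFDerivWithinAt
  refine (measure_mono hsub).trans ((addHaar_image_le_lintegral_abs_det_fderiv volume hJm
    hder).trans ?_)
  simp only [ContinuousLinearMap.det_toSpanSingleton]
  calc _ ≤ ∫⁻ θ in J, ENNReal.ofReal r * speed φ D (circleMap z₀ r θ) := by
        refine setLIntegral_mono' hJm fun θ hθ => ?_
        rw [speed, indicator_of_mem (show circleMap z₀ r θ ∈ D from hθ.2), ← ofReal_norm, ← ENNReal.ofReal_mul hr.le]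
        refine ENNReal.ofReal_le_ofReal ((Complex.abs_re_le_norm _).trans ?_)
        rw [norm_mul, hu, one_mul, norm_mul, norm_mul, norm_circleMap_zero, Complex.norm_I,
          mul_one, abs_of_pos hr, mul_comm]
    _ ≤ ∫⁻ θ in Ioc (-Real.pi) Real.pi, ENNReal.ofReal r * speed φ D (circleMap z₀ r θ) :=
        lintegral_mono_set inter_subset_left
    _ = _ := (setLIntegral_congr Ioo_ae_eq_Ioc).symm

namespace HomeoPair

variable {φ ψ : ℂ → ℂ} {D Ω : Set ℂ} {z₀ : ℂ}

theorem clusterCell_congr {x y : ℂ} (h : x ∈ cell D y) :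
    clusterCell φ D x = clusterCell φ D y := by
  simp only [clusterCell, cell_eq h]

theorem clusterCell_of_mem (h : HomeoPair φ ψ D Ω) {z : ℂ} (hz : z ∈ D) :
    clusterCell φ D z = {φ z} := by
  ext w
  constructor
  · rintro ⟨x, hx, hxw⟩
    rw [cell_of_mem hz] at hx
    obtain rfl : x = z := hx
    exact h.eq_of_mem hxw hz
  · rintro rfl
    exact ⟨z, mem_cell_self _ _, mem_graph hz⟩

theorem cell_eq_of_mem_clusterCell (h : HomeoPair φ ψ D Ω) {x y w : ℂ}
    (hx : w ∈ clusterCell φ D x) (hy : w ∈ clusterCell φ D y) : cell D x = cell D y := by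
  obtain ⟨x', hx', hxw⟩ := hx
  obtain ⟨y', hy', hyw⟩ := hy
  exact Corr.cell_eq_left h ⟨x', hx', w, mem_cell_self _ _, hxw⟩
    ⟨y', hy', w, mem_cell_self _ _, hyw⟩ rfl

/-- The nondegenerate boundary components of `Ω` hit by the circle of radius `r` around `z₀`. -/
def hitComponents (φ : ℂ → ℂ) (D Ω : Set ℂ) (z₀ : ℂ) (r : ℝ) : Set (Set ℂ) :=
  {Q | Q ∈ NondegComponents (frontier Ω) ∧
    ∃ x ∈ sphere z₀ r \ cell D z₀, x ∉ D ∧ Q = clusterCell φ D x}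

theorem eventually_notMem_hitComponents (h : HomeoPair φ ψ D Ω) (z₀ : ℂ) (Q : Set ℂ) :
    ∀ᶠ r in 𝓝[>] (0 : ℝ), Q ∉ hitComponents φ D Ω z₀ r := by
  by_cases hQ : ∃ x, x ∉ cell D z₀ ∧ Q = clusterCell φ D x
  · obtain ⟨x, hx, hQx⟩ := hQ
    have hz : z₀ ∉ cell D x := fun hz => hx ((cell_eq hz) ▸ mem_cell_self D x)
    obtain ⟨δ, hδ, hb⟩ := Metric.isOpen_iff.mp
      (isClosed_cell (z := x) h.isOpen_left).isOpen_compl z₀ hz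
    filter_upwards [Ioo_mem_nhdsGT hδ] with r hr
    rintro ⟨-, y, hy, -, hQy⟩
    obtain ⟨w, hw⟩ := h.clusterCell_nonempty x
    have e := h.cell_eq_of_mem_clusterCell hw (hQy ▸ hQx ▸ hw)
    refine hb (?_ : y ∈ ball z₀ δ) (e ▸ mem_cell_self D y)
    rw [mem_ball, hy.1]
    exact hr.2
  · refine Eventually.of_forall fun r => ?_
    rintro ⟨-, y, hy, -, hQy⟩
    exact hQ ⟨y, hy.2, hQy⟩

theorem eventually_tsum_hitComponents_le (h : HomeoPair φ ψ D Ω) (z₀ : ℂ)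
    (hdiam : ∑' Q : ↥(NondegComponents (frontier Ω)), Metric.ediam (Q : Set ℂ) < ⊤)
    {ε : ENNReal} (hε : 0 < ε) :
    ∀ᶠ r in 𝓝[>] (0 : ℝ), ∑' Q : ↥(hitComponents φ D Ω z₀ r), Metric.ediam (Q : Set ℂ) ≤ ε := by
  obtain ⟨F, hF⟩ := ((ENNReal.tendsto_tsum_compl_atTop_zero hdiam.ne).eventually
    (gt_mem_nhds hε)).exists
  have hev : ∀ᶠ r in 𝓝[>] (0 : ℝ), ∀ Q ∈ F, (Q : Set ℂ) ∉ hitComponents φ D Ω z₀ r :=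
    (F.eventually_all).mpr fun Q _ => h.eventually_notMem_hitComponents z₀ Q
  filter_upwards [hev] with r hr
  let i : ↥(hitComponents φ D Ω z₀ r) → {x : ↥(NondegComponents (frontier Ω)) // x ∉ F} :=
    fun Q => ⟨⟨Q, Q.2.1⟩, fun hQ => hr _ hQ Q.2⟩
  have hi : Function.Injective i := fun Q Q' hQ => Subtype.ext (congrArg (fun x => (x.1 : Set ℂ)) hQ)
  exact (ENNReal.tsum_comp_le_tsum_of_injective hi
    (fun x => Metric.ediam ((x : ↥(NondegComponents (frontier Ω))) : Set ℂ))).trans hF.le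

theorem exists_countable_cover (h : HomeoPair φ ψ D Ω) {S : Set ℂ} (hS : IsPreconnected S)
    (hc : (frontier D ∩ S).Countable) :
    ∃ N : Set ℂ, N.Countable ∧ N ⊆ S \ D ∧
      clusterImage φ D S ⊆ φ '' (D ∩ S) ∪ ⋃ x ∈ N, clusterCell φ D x := by
  have hDf : ∀ x ∈ D, clusterCell φ D x ⊆ {φ x} := fun x hx => (h.clusterCell_of_mem hx).subset
  by_cases hex : ∃ z ∈ S \ D, S ⊆ cell D z
  · obtain ⟨z, hz, hSz⟩ := hex
    refine ⟨{z}, countable_singleton z, by simpa using hz, ?_⟩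
    rintro w ⟨x, hx, hw⟩
    right
    rw [clusterCell_congr (hSz hx)] at hw
    simpa using hw
  · refine ⟨frontier D ∩ S, hc, ?_, ?_⟩
    · rintro x ⟨hx, hxS⟩
      rw [h.isOpen_left.frontier_eq] at hx
      exact ⟨hxS, hx.2⟩
    rintro w ⟨x, hx, hw⟩
    by_cases hxD : x ∈ D
    · left
      rw [hDf x hxD hw]
      exact ⟨x, ⟨hxD, hx⟩, rfl⟩
    · right
      have hne : (S ∩ frontier (cell D x)).Nonempty := by
        by_contra hemp
        rw [not_nonempty_iff_eq_empty] at hemp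
        have hcover : S ⊆ interior (cell D x) ∪ (cell D x)ᶜ := by
          intro y hy
          by_cases hyc : y ∈ cell D x
          · left
            by_contra hyi
            have : y ∈ S ∩ frontier (cell D x) :=
              ⟨hy, by rw [(isClosed_cell h.isOpen_left).frontier_eq]; exact ⟨hyc, hyi⟩⟩
            rw [hemp] at this
            exact this
          · exact Or.inr hyc
        rcases isPreconnected_iff_subset_of_disjoint.mp hS _ _ isOpen_interior
          (isClosed_cell h.isOpen_left).isOpen_compl hcover (by
            rw [← subset_empty_iff]
            rintro y ⟨-, h1, h2⟩
            exact h2 (interior_subset h1)) with h1 | h1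
        · exact hex ⟨x, ⟨hx, hxD⟩, h1.trans interior_subset⟩
        · exact h1 hx (mem_cell_self D x)
      obtain ⟨y, hyS, hy⟩ := hne
      rw [← cell_inter_frontier h.isOpen_left hxD] at hy
      rw [← clusterCell_congr hy.1] at hw
      exact mem_biUnion (show y ∈ frontier D ∩ S from ⟨hy.2, hyS⟩) hw

theorem volume_projection_clusterImage_le (h : HomeoPair φ ψ D Ω) (hφ : DifferentiableOn ℂ φ D)
    (hcount : (NondegComponents (frontier Ω)).Countable) {r : ℝ} (hr : 0 < r)
    (hS : IsPreconnected (sphere z₀ r \ cell D z₀))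
    (hc : (frontier D ∩ sphere z₀ r).Countable) {u : ℂ} (hu : ‖u‖ = 1) :
    volume ((fun w => (u * w).re) '' clusterImage φ D (sphere z₀ r \ cell D z₀)) ≤
      (∫⁻ θ in Ioo (-Real.pi) Real.pi, ENNReal.ofReal r * speed φ D (circleMap z₀ r θ)) +
        ∑' Q : ↥(hitComponents φ D Ω z₀ r), Metric.ediam (Q : Set ℂ) := by
  obtain ⟨N, hN, hNS, hcov⟩ := h.exists_countable_cover hS
    (hc.mono (inter_subset_inter_right _ sdiff_subset))
  set π : ℂ → ℝ := fun w => (u * w).re with hπ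
  have hlip : LipschitzWith 1 π := by
    refine LipschitzWith.of_dist_le_mul fun a b => ?_
    rw [NNReal.coe_one, one_mul, Real.dist_eq, dist_eq_norm, hπ]
    simp only
    rw [← Complex.sub_re, ← mul_sub]
    refine (Complex.abs_re_le_norm _).trans ?_
    rw [norm_mul, hu, one_mul]
  set T : Set ℂ := ⋃ x ∈ {x ∈ N | (clusterCell φ D x).Subsingleton}, clusterCell φ D x with hT
  have hTc : T.Countable := (hN.mono (sep_subset _ _)).biUnion fun x hx => hx.2.countable
  have hsub : clusterImage φ D (sphere z₀ r \ cell D z₀) ⊆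
      (φ '' (D ∩ sphere z₀ r) ∪ T) ∪ ⋃ Q ∈ hitComponents φ D Ω z₀ r, Q := by
    refine hcov.trans (union_subset ?_ ?_)
    · exact ((image_mono (inter_subset_inter_right _ sdiff_subset)).trans
        subset_union_left).trans subset_union_left
    · refine iUnion₂_subset fun x hx => ?_
      by_cases hs : (clusterCell φ D x).Subsingleton
      · have : clusterCell φ D x ⊆ T := subset_biUnion_of_mem (u := fun x => clusterCell φ D x)
          (show x ∈ {x ∈ N | (clusterCell φ D x).Subsingleton} from ⟨hx, hs⟩)
        exact (this.trans subset_union_right).trans subset_union_left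
      · refine subset_trans ?_ subset_union_right
        refine subset_biUnion_of_mem (u := fun Q : Set ℂ => Q) ?_
        rw [not_subsingleton_iff] at hs
        obtain ⟨w, hw⟩ := hs.nonempty
        obtain ⟨h1, h2⟩ := h.clusterCell_eq_component (hNS hx).2 hw
        exact ⟨⟨⟨w, h1, h2⟩, hs⟩, x, (hNS hx).1, (hNS hx).2, rfl⟩
  have hHc : (hitComponents φ D Ω z₀ r).Countable := hcount.mono fun Q hQ => hQ.1
  calc _ ≤ volume (π '' ((φ '' (D ∩ sphere z₀ r) ∪ T) ∪ ⋃ Q ∈ hitComponents φ D Ω z₀ r, Q)) :=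
        measure_mono (image_mono hsub)
    _ ≤ (volume (π '' (φ '' (D ∩ sphere z₀ r))) + volume (π '' T)) +
        volume (π '' ⋃ Q ∈ hitComponents φ D Ω z₀ r, Q) := by
        rw [image_union, image_union]
        exact (measure_union_le _ _).trans (add_le_add_left (measure_union_le _ _) _)
    _ ≤ _ := by
        rw [(hTc.image π).measure_zero, add_zero]
        refine add_le_add (volume_projection_circle_le h.isOpen_left hφ z₀ hr hu) ?_
        rw [image_iUnion₂]
        refine (measure_biUnion_le volume hHc _).trans (ENNReal.tsum_le_tsum fun Q => ?_)
        refine (Real.volume_le_diam _).trans ?_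
        simpa using hlip.ediam_image_le (Q : Set ℂ)

theorem exists_small_clusterImage (h : HomeoPair φ ψ D Ω) (hφ : IsConformalHomeoOnto φ D Ω)
    (hcount : (NondegComponents (frontier Ω)).Countable)
    (hdiam : ∑' Q : ↥(NondegComponents (frontier Ω)), Metric.ediam (Q : Set ℂ) < ⊤)
    (hD : IsCircleDomain D) (hDσ : SigmaFiniteH1 (frontier D)) (hz : z₀ ∈ frontier D)
    {ε δ : ℝ} (hε : 0 < ε) (hδ : 0 < δ) :
    ∃ r ∈ Ioo 0 δ, ∀ p ∈ clusterImage φ D (sphere z₀ r \ cell D z₀),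
      ∀ q ∈ clusterImage φ D (sphere z₀ r \ cell D z₀), dist p q ≤ ε := by
  have hev := h.eventually_tsum_hitComponents_le z₀ hdiam
    (ε := ENNReal.ofReal (ε / 2)) (by simpa using hε)
  obtain ⟨δ', hδ', hsub⟩ := mem_nhdsGT_iff_exists_Ioo_subset.mp hev
  have hfin : ∫⁻ z, speed φ D z ^ 2 ≠ ⊤ := by
    rw [lintegral_speed_sq h.isOpen_left hφ]
    exact h.isBounded_right.measure_lt_top.ne
  obtain ⟨r, hr, hc, hlt⟩ := exists_short_circle z₀ (measurable_speed φ h.isOpen_left) hfin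
    (half_pos hε) (lt_min hδ hδ') (hDσ.ae_countable_inter_sphere z₀)
  have hr0 : (0 : ℝ) < r := hr.1
  refine ⟨r, ⟨hr0, hr.2.trans_le (min_le_left _ _)⟩, fun p hp q hq => ?_⟩
  have hS := hD.isPreconnected_sphere_sdiff hz hr0
  have hA := h.isPreconnected_clusterImage hS
  rcases eq_or_ne p q with rfl | hpq
  · rw [dist_self]; exact hε.le
  have hn : ‖p - q‖ ≠ 0 := norm_ne_zero_iff.mpr (sub_ne_zero.mpr hpq)
  set u : ℂ := (starRingEnd ℂ (p - q)) / ‖p - q‖ with hu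
  have hu1 : ‖u‖ = 1 := by
    rw [hu, norm_div, RCLike.norm_conj, Complex.norm_real, norm_norm, div_self hn]
  have hdist : (u * p).re - (u * q).re = dist p q := by
    rw [← Complex.sub_re, ← mul_sub, hu, div_mul_eq_mul_div, ← Complex.normSq_eq_conj_mul_self,
      Complex.normSq_eq_norm_sq, dist_eq_norm, ← Complex.ofReal_div, Complex.ofReal_re]
    field_simp
  have hcont : Continuous fun w : ℂ => (u * w).re := by fun_prop
  have hord := (hA.image _ hcont.continuousOn).ordConnected.out (mem_image_of_mem _ hq)
    (mem_image_of_mem _ hp)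
  have h1 := (measure_mono hord).trans (h.volume_projection_clusterImage_le hφ.1 hcount hr0 hS hc hu1)
  rw [Real.volume_Icc, hdist] at h1
  have h2 : ENNReal.ofReal (dist p q) ≤ ENNReal.ofReal (ε / 2) + ENNReal.ofReal (ε / 2) :=
    h1.trans (add_le_add hlt.le (hsub ⟨hr0, hr.2.trans_le (min_le_right _ _)⟩))
  rw [← ENNReal.ofReal_add (by positivity) (by positivity), add_halves] at h2
  exact (ENNReal.ofReal_le_ofReal_iff hε.le).mp h2

end HomeoPair

theorem exists_uniform_connected_nhd {P : Set ℂ} (hP : IsCompact P) [LocallyConnectedSpace ↥P]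
    {η : ℝ} (hη : 0 < η) :
    ∃ ε > 0, ε ≤ η ∧ ∀ w, ∃ L, IsClosed L ∧ IsPreconnected L ∧ L ⊆ P ∧
      P ∩ closedBall w ε ⊆ L ∧ L ⊆ closedBall w η := by
  have hloc : ∀ x : P, ∃ c : Set ℂ, IsOpen c ∧ (x : ℂ) ∈ c ∧ IsPreconnected (P ∩ c) ∧
      P ∩ c ⊆ ball (x : ℂ) (η / 4) := by
    intro x
    obtain ⟨V, hVsub, hV, hxV, hVc⟩ := locallyConnectedSpace_iff_subsets_isOpen_isConnected.mp ‹_›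
      x (Subtype.val ⁻¹' ball (x : ℂ) (η / 4))
      ((isOpen_ball.preimage continuous_subtype_val).mem_nhds (mem_ball_self (by positivity)))
    obtain ⟨c, hc, rfl⟩ := isOpen_induced_iff.mp hV
    have e : P ∩ c = Subtype.val '' (Subtype.val ⁻¹' c : Set P) :=
      (Subtype.image_preimage_coe P c).symm
    refine ⟨c, hc, hxV, ?_, ?_⟩
    · rw [e]
      exact hVc.isPreconnected.image _ continuous_subtype_val.continuousOn
    · rw [e]
      rintro _ ⟨y, hy, rfl⟩
      exact hVsub hy
  choose c hc hxc hpre hsmall using hloc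
  obtain ⟨δ, hδ, hL⟩ := lebesgue_number_lemma_of_metric hP hc
    (fun x hx => mem_iUnion.mpr ⟨⟨x, hx⟩, hxc ⟨x, hx⟩⟩)
  refine ⟨min (δ / 4) (η / 4), by positivity, (min_le_right _ _).trans (by linarith), fun w => ?_⟩
  rcases (P ∩ closedBall w (min (δ / 4) (η / 4))).eq_empty_or_nonempty with h | ⟨t, htP, ht⟩
  · exact ⟨∅, isClosed_empty, isPreconnected_empty, empty_subset _, h.subset, empty_subset _⟩
  obtain ⟨x, hx⟩ := hL t htP
  rw [mem_closedBall] at ht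
  have ht1 := ht.trans (min_le_left _ _)
  have ht2 := ht.trans (min_le_right _ _)
  refine ⟨closure (P ∩ c x), isClosed_closure, (hpre x).closure,
    closure_minimal inter_subset_left hP.isClosed, ?_, ?_⟩
  · rintro y ⟨hyP, hy⟩
    refine subset_closure ⟨hyP, hx ?_⟩
    rw [mem_closedBall] at hy
    rw [mem_ball]
    have := hy.trans (min_le_left _ _)
    linarith [dist_triangle_right y t w]
  · refine closure_minimal (fun y hy => ?_) isClosed_closedBall
    have h1 := mem_ball.mp (hsmall x hy)
    have h2 := mem_ball.mp (hsmall x ⟨htP, hx (mem_ball_self hδ)⟩)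
    rw [mem_closedBall]
    linarith [dist_triangle_right y t x, dist_triangle y t w]

theorem IsPreconnected.subset_or_disjoint_of_frontier {B C : Set ℂ} (hB : IsPreconnected B)
    (hC : IsClosed C) (hd : Disjoint B (frontier C)) : B ⊆ interior C ∨ Disjoint B C := by
  have hcover : B ⊆ interior C ∪ Cᶜ := by
    intro y hy
    by_cases hyc : y ∈ C
    · left
      by_contra hyi
      exact disjoint_left.mp hd hy (by rw [hC.frontier_eq]; exact ⟨hyc, hyi⟩)
    · exact Or.inr hyc
  rw [← subset_compl_iff_disjoint_right]
  refine isPreconnected_iff_subset_of_disjoint.mp hB _ _ isOpen_interior hC.isOpen_compl hcover ?_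
  rw [← subset_empty_iff]
  rintro y ⟨-, h1, h2⟩
  exact h2 (interior_subset h1)

namespace HomeoPair

variable {φ ψ : ℂ → ℂ} {D Ω : Set ℂ} {z₀ : ℂ}

theorem corrImage_subset_ball (h : HomeoPair φ ψ D Ω) {S : Set ℂ} {w : ℂ} {ρ : ℝ}
    (hA : clusterImage φ D S ⊆ ball w ρ) (hΩ : ¬ Ω ⊆ ball w ρ) :
    corrImage φ D Ω S ⊆ ball w ρ := by
  rintro v ⟨z, hz, z', hz', v', hv', hp⟩
  have hvA : v' ∈ clusterImage φ D S := ⟨z, hz, z', hz', hp⟩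
  by_cases hv : v ∈ Ω
  · rw [cell_of_mem hv] at hv'
    obtain rfl : v' = v := hv'
    exact hA hvA
  · have hfr : frontier (cell Ω v) ⊆ ball w ρ := by
      rw [← cell_inter_frontier h.isOpen_right hv,
        inter_frontier_eq_inter_closure h.isOpen_right (cell_subset_compl hv), ← cell_eq hv',
        ← h.clusterCell_eq hp, clusterCell_congr hz']
      exact fun y hy => hA ⟨z, hz, hy⟩
    rcases (isPreconnected_compl_ball w ρ).subset_or_disjoint_of_frontier
      (isClosed_cell h.isOpen_right) (disjoint_compl_left.mono_right hfr) with h1 | h1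
    · refine absurd (fun x hx => ?_) hΩ
      by_contra hxb
      exact cell_subset_compl hv (interior_subset (h1 hxb)) hx
    · rw [disjoint_compl_left_iff_subset] at h1
      exact h1 (mem_cell_self _ _)

theorem corr_of_mem {z : ℂ} (hz : z ∈ D) : Corr φ D Ω z (φ z) :=
  ⟨z, mem_cell_self _ _, φ z, mem_cell_self _ _, mem_graph hz⟩

/-- The union of the cells of `Ω` corresponding to cells of `D` contained in `N`. -/
def innerImage (φ : ℂ → ℂ) (D Ω N : Set ℂ) : Set ℂ := corrImage φ D Ω {z | cell D z ⊆ N}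

theorem isOpen_innerImage (h : HomeoPair φ ψ D Ω) {N : Set ℂ} (hN : IsOpen N) :
    IsOpen (innerImage φ D Ω N) := by
  refine h.isOpen_corrImage
    (isOpen_setOf_cell_subset h.isOpen_left h.isConnected_left h.isBounded_left hN) ?_
  intro z hz x hx
  change cell D x ⊆ N
  rw [cell_eq hx]; exact hz

theorem disjoint_innerImage (h : HomeoPair φ ψ D Ω) {M N : Set ℂ} (hMN : Disjoint M N) :
    Disjoint (innerImage φ D Ω M) (innerImage φ D Ω N) := by
  rw [disjoint_left]
  rintro w ⟨x, hx, hxw⟩ ⟨y, hy, hyw⟩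
  have e := Corr.cell_eq_left h hxw hyw rfl
  exact disjoint_left.mp hMN (hx (mem_cell_self _ _)) (hy (e ▸ mem_cell_self _ _))

theorem innerImage_union_eq (h : HomeoPair φ ψ D Ω) {w₀ : ℂ} (h0 : Corr φ D Ω z₀ w₀) (r : ℝ) :
    innerImage φ D Ω (ball z₀ r \ cell D z₀) ∪ innerImage φ D Ω ((closedBall z₀ r)ᶜ \ cell D z₀) =
      (corrImage φ D Ω (sphere z₀ r \ cell D z₀) ∪ cell Ω w₀)ᶜ := by
  have hcell : ∀ {x w}, Corr φ D Ω x w → w ∈ cell Ω w₀ → cell D x = cell D z₀ :=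
    fun hxw hw => Corr.cell_eq_left h hxw h0 (cell_eq hw)
  ext w
  constructor
  · rintro (⟨x, hx, hxw⟩ | ⟨x, hx, hxw⟩)
    all_goals
      rintro (⟨y, hy, hyw⟩ | hw)
      · have e := Corr.cell_eq_left h hxw hyw rfl
        have hyx := hx (e ▸ mem_cell_self D y : y ∈ cell D x)
        have := hy.1
        have := hyx.1
        simp only [mem_ball, mem_sphere, mem_compl_iff, mem_closedBall] at *
        linarith
      · have e := hcell hxw hw
        exact (hx (mem_cell_self _ _)).2 (e ▸ mem_cell_self _ _)
  · intro hw
    obtain ⟨x, hx⟩ := h.exists_corr_right w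
    have hne : Disjoint (cell D x) (cell D z₀) := by
      rw [disjoint_left]
      intro y hy hy0
      refine hw (Or.inr ?_)
      rw [← Corr.cell_eq_right h hx h0 (cell_eq_of_mem_of_mem hy hy0)]
      exact mem_cell_self _ _
    have hns : ∀ y ∈ cell D x, dist y z₀ ≠ r := by
      intro y hy hyr
      refine hw (Or.inl ⟨y, ⟨hyr, disjoint_left.mp hne hy⟩, ?_⟩)
      obtain ⟨x', hx', w', hw', hp⟩ := hx
      exact ⟨x', by rwa [cell_eq hy], w', hw', hp⟩
    have hcover : cell D x ⊆ ball z₀ r ∪ (closedBall z₀ r)ᶜ := by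
      intro y hy
      rcases lt_or_gt_of_ne (hns y hy) with h1 | h1
      · exact Or.inl h1
      · exact Or.inr (not_le.mpr h1)
    rcases isPreconnected_iff_subset_of_disjoint.mp (isPreconnected_cell (D := D) (z := x)) _ _
      isOpen_ball isClosed_closedBall.isOpen_compl hcover (by
        rw [← subset_empty_iff]
        rintro y ⟨-, h1, h2⟩
        exact h2 (ball_subset_closedBall h1)) with h1 | h1
    · exact Or.inl ⟨x, fun y hy => ⟨h1 hy, disjoint_left.mp hne hy⟩, hx⟩
    · exact Or.inr ⟨x, fun y hy => ⟨h1 hy, disjoint_left.mp hne hy⟩, hx⟩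

theorem mem_innerImage_of_mem {N : Set ℂ} {z : ℂ} (hz : z ∈ D) (hzN : z ∈ N) :
    φ z ∈ innerImage φ D Ω N :=
  ⟨z, by simpa [cell_of_mem hz] using hzN, corr_of_mem hz⟩

theorem isBounded_or_isBounded_of_union_eq (h : HomeoPair φ ψ D Ω) {w₀ : ℂ} (hw₀ : w₀ ∉ Ω)
    {U V A : Set ℂ} (hU : IsOpen U) (hV : IsOpen V) (hd : Disjoint U V)
    (hA : Bornology.IsBounded A) (hUV : U ∪ V = (A ∪ cell Ω w₀)ᶜ) :
    Bornology.IsBounded U ∨ Bornology.IsBounded V := by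
  obtain ⟨R, hR⟩ := (hA.union h.isBounded_right).subset_ball 0
  have hB := isPreconnected_compl_ball 0 R
  have hbdd : ∀ W, Disjoint (ball (0 : ℂ) R)ᶜ W → Bornology.IsBounded W := by
    intro W hW
    rw [disjoint_compl_left_iff_subset] at hW
    exact isBounded_ball.subset hW
  by_cases hm : Disjoint (ball (0 : ℂ) R)ᶜ (cell Ω w₀)
  · have hcover : (ball (0 : ℂ) R)ᶜ ⊆ U ∪ V := by
      rw [hUV]
      rintro y hy (hyA | hyc)
      · exact hy (hR (Or.inl hyA))
      · exact disjoint_left.mp hm hy hyc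
    rcases isPreconnected_iff_subset_of_disjoint.mp hB U V hU hV hcover
      (by rw [hd.inter_eq, inter_empty]) with h1 | h1
    · exact Or.inr (hbdd V (hd.mono_left h1))
    · exact Or.inl (hbdd U (hd.symm.mono_left h1))
  · obtain ⟨y, hy, hyc⟩ := not_disjoint_iff.mp hm
    have hyΩ : y ∉ Ω := cell_subset_compl hw₀ hyc
    have hsub : (ball (0 : ℂ) R)ᶜ ⊆ cell Ω w₀ := by
      rw [← cell_eq hyc, cell_of_notMem hyΩ]
      exact hB.subset_connectedComponentIn hy fun x hx hxΩ => hx (hR (Or.inr hxΩ))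
    left
    refine hbdd U (disjoint_left.mpr fun x hx hxU => ?_)
    have : x ∈ (A ∪ cell Ω w₀)ᶜ := hUV ▸ Or.inl hxU
    exact this (Or.inr (hsub hx))

theorem exists_image_ball_subset (h : HomeoPair φ ψ D Ω) (hφ : IsConformalHomeoOnto φ D Ω)
    (hcount : (NondegComponents (frontier Ω)).Countable)
    (hdiam : ∑' Q : ↥(NondegComponents (frontier Ω)), Metric.ediam (Q : Set ℂ) < ⊤)
    (hD : IsCircleDomain D) (hDσ : SigmaFiniteH1 (frontier D)) (hz : z₀ ∈ frontier D)
    (hP : IsPeanoCompactum (frontier Ω)) {η : ℝ} (hη : 0 < η) :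
    ∃ r > 0, ∃ w, φ '' (D ∩ ball z₀ r) ⊆ ball w η := by
  have hzD : z₀ ∉ D := by
    rw [h.isOpen_left.frontier_eq] at hz; exact hz.2
  obtain ⟨w₀, hw₀⟩ := h.exists_mem_graph (frontier_subset_closure hz)
  have hw₀Ω : w₀ ∉ Ω := fun hw => hzD ((h.mem_iff hw₀).mpr hw)
  have h0 : Corr φ D Ω z₀ w₀ := ⟨z₀, mem_cell_self _ _, w₀, mem_cell_self _ _, hw₀⟩
  obtain ⟨hw₀f, hcc⟩ := h.clusterCell_eq_component hzD (w := w₀) ⟨z₀, mem_cell_self _ _, hw₀⟩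
  have hPeq := h.clusterCell_eq hw₀
  set P := clusterCell φ D z₀ with hPdef
  have hPc : IsCompact P := h.isCompact_clusterCell
  have hPl : LocallyConnectedSpace ↥P := by
    rw [hcc]; exact hP.2.1 w₀ hw₀f
  obtain ⟨b₁, hb₁, b₂, hb₂, hb⟩ := hD.1.exists_ne
  have hφb : 0 < dist (φ b₁) (φ b₂) :=
    dist_pos.mpr fun e => hb (hφ.2.injOn hb₁ hb₂ e)
  set η' := min (η / 2) (dist (φ b₁) (φ b₂) / 4) with hη'
  have hη'0 : 0 < η' := by positivity
  obtain ⟨ε, hε, hεη, hL⟩ := exists_uniform_connected_nhd hPc hη'0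
  have hd₁ : 0 < dist b₁ z₀ := dist_pos.mpr fun e => hzD (e ▸ hb₁)
  have hd₂ : 0 < dist b₂ z₀ := dist_pos.mpr fun e => hzD (e ▸ hb₂)
  obtain ⟨r, hr, hA⟩ := h.exists_small_clusterImage hφ hcount hdiam hD hDσ hz (half_pos hε)
    (lt_min hd₁ hd₂)
  have hrb₁ : r < dist b₁ z₀ := hr.2.trans_le (min_le_left _ _)
  have hrb₂ : r < dist b₂ z₀ := hr.2.trans_le (min_le_right _ _)
  set S := sphere z₀ r \ cell D z₀ with hS
  obtain ⟨w, hw⟩ : ∃ w, clusterImage φ D S ⊆ ball w ε := by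
    rcases (clusterImage φ D S).eq_empty_or_nonempty with he | ⟨w, hw⟩
    · exact ⟨0, by rw [he]; exact empty_subset _⟩
    · refine ⟨w, fun p hp => ?_⟩
      rw [mem_ball]
      linarith [hA p hp w hw]
  have hbη : ∃ b ∈ D, r < dist b z₀ ∧ φ b ∉ closedBall w η' := by
    by_contra! hcon
    have h1 := mem_closedBall.mp (hcon b₁ hb₁ hrb₁)
    have h2 := mem_closedBall.mp (hcon b₂ hb₂ hrb₂)
    have := min_le_right (η / 2) (dist (φ b₁) (φ b₂) / 4)
    linarith [dist_triangle_right (φ b₁) (φ b₂) w]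
  obtain ⟨b, hbD, hbr, hbw⟩ := hbη
  have hball : ball w ε ⊆ closedBall w η' :=
    ball_subset_closedBall.trans (closedBall_subset_closedBall hεη)
  have hΩ : ¬ Ω ⊆ ball w ε := fun hsub => hbw (hball (hsub (h.mapsTo_left hbD)))
  have hÂ := h.corrImage_subset_ball hw hΩ
  set A := corrImage φ D Ω S with hAdef
  obtain ⟨L, hLc, hLp, hLP, hPL, hLη⟩ := hL w
  have hPE : P ⊆ cell Ω w₀ := by rw [hPeq]; exact inter_subset_left
  set U := innerImage φ D Ω (ball z₀ r \ cell D z₀) with hUdef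
  set V := innerImage φ D Ω ((closedBall z₀ r)ᶜ \ cell D z₀) with hVdef
  have hEc : IsClosed (cell D z₀) := isClosed_cell h.isOpen_left
  have hE'c : IsClosed (cell Ω w₀) := isClosed_cell h.isOpen_right
  have hU : IsOpen U := h.isOpen_innerImage (isOpen_ball.sdiff hEc)
  have hV : IsOpen V := h.isOpen_innerImage (isClosed_closedBall.isOpen_compl.sdiff hEc)
  have hUVd : Disjoint U V := by
    refine h.disjoint_innerImage (disjoint_left.mpr ?_)
    rintro y ⟨h1, -⟩ ⟨h2, -⟩
    exact h2 (ball_subset_closedBall h1)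
  have hUV : U ∪ V = (A ∪ cell Ω w₀)ᶜ := h.innerImage_union_eq h0 r
  have hclA : closure A ⊆ A ∪ cell Ω w₀ := by
    have hcl : IsClosed (A ∪ cell Ω w₀) := by
      rw [← isOpen_compl_iff, ← hUV]; exact hU.union hV
    exact closure_minimal subset_union_left hcl
  have hunion : (closure A ∪ L) ∪ cell Ω w₀ = A ∪ cell Ω w₀ := by
    apply subset_antisymm
    · exact union_subset (union_subset hclA (hLP.trans (hPE.trans subset_union_right)))
        subset_union_right
    · exact union_subset_union_left _ (subset_closure.trans subset_union_left)
  have hAE : Disjoint A (cell Ω w₀) := by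
    rw [disjoint_left]
    rintro y ⟨x, hx, hxy⟩ hy
    exact hx.2 (Corr.cell_eq_left h hxy h0 (cell_eq hy) ▸ mem_cell_self D x)
  have hT : closure A ∩ cell Ω w₀ ⊆ L := by
    rintro y ⟨hyA, hyE⟩
    apply hPL
    refine ⟨?_, (closure_mono hÂ).trans closure_ball_subset_closedBall hyA⟩
    rw [hPeq, ← inter_frontier_eq_inter_closure h.isOpen_right (cell_subset_compl hw₀Ω),
      cell_inter_frontier h.isOpen_right hw₀Ω, frontier_eq_closure_inter_closure]
    exact ⟨subset_closure hyE, closure_mono hAE.subset_compl_right hyA⟩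
  have hAL : (closure A ∪ L) ∩ cell Ω w₀ = L := by
    rw [union_inter_distrib_right, inter_eq_left.mpr (hLP.trans hPE)]
    exact union_eq_right.mpr hT
  have hsmall : closure A ∪ L ⊆ closedBall w η' := by
    refine union_subset ?_ hLη
    exact closure_minimal (hÂ.trans hball) isClosed_closedBall
  refine ⟨r, hr.1, w, ?_⟩
  rintro _ ⟨a, ⟨haD, ha⟩, rfl⟩
  have hη2 : η' < η := (min_le_left _ _).trans_lt (by linarith)
  by_contra hφa
  obtain ⟨ρ, hρ1, hρ2⟩ : ∃ ρ, η' < ρ ∧ ρ ≤ min (dist (φ a) w) (dist (φ b) w) := by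
    refine ⟨_, lt_min ?_ ?_, le_rfl⟩
    · rw [mem_ball, not_lt] at hφa
      exact hη2.trans_le hφa
    · rw [mem_closedBall, not_le] at hbw
      exact hbw
  have hE0 : ∀ x ∈ D, x ∉ cell D z₀ := fun x hx hxc => cell_subset_compl hzD hxc hx
  refine janiszewski (isClosed_closure.union hLc) hE'c (by rw [hAL]; exact hLp)
    (x := φ a) (y := φ b) (isPreconnected_compl_ball w ρ) ?_ ?_ ?_
    h.isConnected_right.isPreconnected ?_ (h.mapsTo_left haD) (h.mapsTo_left hbD)
    hU hV hUVd (by rw [hunion]; exact hUV) (mem_innerImage_of_mem haD ⟨ha, hE0 a haD⟩)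
    (mem_innerImage_of_mem hbD ⟨not_le.mpr hbr, hE0 b hbD⟩)
    (h.isBounded_or_isBounded_of_union_eq hw₀Ω hU hV hUVd (isBounded_ball.subset hÂ) hUV)
  · exact disjoint_compl_left.mono_right (hsmall.trans (closedBall_subset_ball hρ1))
  · exact not_lt.mpr (hρ2.trans (min_le_left _ _))
  · exact not_lt.mpr (hρ2.trans (min_le_right _ _))
  · exact disjoint_left.mpr fun x hx hxc => cell_subset_compl hw₀Ω hxc hx

theorem exists_extension (h : HomeoPair φ ψ D Ω) (hφ : IsConformalHomeoOnto φ D Ω)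
    (hcount : (NondegComponents (frontier Ω)).Countable)
    (hdiam : ∑' Q : ↥(NondegComponents (frontier Ω)), Metric.ediam (Q : Set ℂ) < ⊤)
    (hD : IsCircleDomain D) (hDσ : SigmaFiniteH1 (frontier D))
    (hP : IsPeanoCompactum (frontier Ω)) : ∃ φb, ExtendsContinuously φ φb D Ω := by
  have hlim : ∀ z ∈ closure D, ∃ y, Tendsto φ (𝓝[D] z) (𝓝 y) := by
    intro z hz
    by_cases hzD : z ∈ D
    · exact ⟨φ z, h.continuousOn_left z hzD⟩
    have hzf : z ∈ frontier D := by
      rw [h.isOpen_left.frontier_eq]; exact ⟨hz, hzD⟩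
    have hne : (𝓝[D] z).NeBot := mem_closure_iff_nhdsWithin_neBot.mp hz
    refine CompleteSpace.complete (Metric.cauchy_iff.mpr ⟨hne.map φ, fun ε hε => ?_⟩)
    obtain ⟨r, hr, w, hw⟩ :=
      h.exists_image_ball_subset hφ hcount hdiam hD hDσ hzf hP (half_pos hε)
    refine ⟨φ '' (D ∩ ball z r), image_mem_map ?_, fun x hx y hy => ?_⟩
    · exact inter_mem self_mem_nhdsWithin (mem_nhdsWithin_of_mem_nhds (ball_mem_nhds z hr))
    · have h1 := mem_ball.mp (hw hx)
      have h2 := mem_ball.mp (hw hy)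
      linarith [dist_triangle_right x y w]
  have hcont := continuousOn_extendFrom subset_rfl hlim
  have heq : EqOn (extendFrom D φ) φ D := fun z hz =>
    extendFrom_eq (subset_closure hz) (h.continuousOn_left z hz)
  refine ⟨extendFrom D φ, hcont, heq, ?_⟩
  rw [mapsTo_iff_image_subset]
  refine hcont.image_closure.trans (closure_mono ?_)
  rintro _ ⟨z, hz, rfl⟩
  rw [heq hz]
  exact h.mapsTo_left hz

end HomeoPair

/-- Second generalization of Carathéodory's continuity theorem. -/
theorem stmt_4 (D Ω : Set ℂ) (φ : ℂ → ℂ)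
    (hΩ : IsPlanarDomain Ω) (hΩb : Bornology.IsBounded Ω)
    (hcount : (NondegComponents (frontier Ω)).Countable)
    (hdiam : ∑' Q : ↥(NondegComponents (frontier Ω)), EMetric.diam (Q : Set ℂ) < ⊤)
    (hD : IsCircleDomain D)
    (hDσ : SigmaFiniteH1 (frontier D))
    (hφ : IsConformalHomeoOnto φ D Ω) :
    (∃ φb : ℂ → ℂ, ExtendsContinuously φ φb D Ω) ↔ IsPeanoCompactum (frontier Ω) := by
  have h := hφ.homeoPair hD.1 hD.2.1 hΩ hΩb
  exact ⟨fun ⟨φb, he⟩ => isPeanoCompactum_of_extends h hD hdiam he,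
    fun hP => h.exists_extension hφ hcount hdiam hD hDσ hP⟩
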